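/- Let F be an algebraically closed field of characteristic ℓ and G ≤ GL(V) a group with a normal subgroup N ≤ Sp(V). Then: (i) for every k with 1 ≤ k ≤ dim(V) − 1, the N-module ⋀^k(V) contains a submodule isomorphic to the trivial module 1_N if k is even and to V|_N if k is odd; (ii) if N is finite and O^ℓ(N) is not abelian, then ⋀^k(V) cannot be irreducible over G for any k with 2 ≤ k ≤ dim(V) − 2. -/

import Mathlib

open scoped TensorProduct
open Matrix

noncomputable section

namespace GuralnickTiep

variable {F : Type*} [Field F] {d : ℕ}

/-- The substitution action of a matrix `g` on polynomials, extending the linear action of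
`g` on the span of the variables: `X i ↦ ∑ j, g j i • X j`. -/
def matSubst (g : Matrix (Fin d) (Fin d) F) :
    MvPolynomial (Fin d) F →ₐ[F] MvPolynomial (Fin d) F :=
  MvPolynomial.aeval fun i => ∑ j, MvPolynomial.C (g j i) * MvPolynomial.X j

/-- The `k`-th symmetric power of `F^d`, realized as the space of homogeneous polynomials
of degree `k` in `d` variables. -/
abbrev symPow (F : Type*) [Field F] (d k : ℕ) : Submodule F (MvPolynomial (Fin d) F) :=
  MvPolynomial.homogeneousSubmodule (Fin d) F k

def SymInvariant (G : Subgroup (GL (Fin d) F)) (W : Submodule F (MvPolynomial (Fin d) F)) : Prop :=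
  ∀ g ∈ G, ∀ p ∈ W, matSubst ((g : GL (Fin d) F) : Matrix (Fin d) (Fin d) F) p ∈ W

/-- `Sym^k(V)` is irreducible as a module over the subgroup `G ≤ GL(V)`. -/
def SymIrreducible (G : Subgroup (GL (Fin d) F)) (k : ℕ) : Prop :=
  symPow F d k ≠ ⊥ ∧
    ∀ W : Submodule F (MvPolynomial (Fin d) F),
      W ≤ symPow F d k → SymInvariant G W → W = ⊥ ∨ W = symPow F d k

/-- action of `g` on the exterior algebra of `F^d`. -/
def extSubst (g : Matrix (Fin d) (Fin d) F) :
    ExteriorAlgebra F (Fin d → F) →ₐ[F] ExteriorAlgebra F (Fin d → F) :=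
  ExteriorAlgebra.map g.mulVecLin

def ExtInvariant (G : Subgroup (GL (Fin d) F))
    (W : Submodule F (ExteriorAlgebra F (Fin d → F))) : Prop :=
  ∀ g ∈ G, ∀ v ∈ W, extSubst ((g : GL (Fin d) F) : Matrix (Fin d) (Fin d) F) v ∈ W

/-- `⋀^k(V)` is irreducible as a module over the subgroup `G ≤ GL(V)`. -/
def ExtIrreducible (G : Subgroup (GL (Fin d) F)) (k : ℕ) : Prop :=
  (⋀[F]^k (Fin d → F)) ≠ ⊥ ∧
    ∀ W : Submodule F (ExteriorAlgebra F (Fin d → F)),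
      W ≤ ⋀[F]^k (Fin d → F) → ExtInvariant G W → W = ⊥ ∨ W = ⋀[F]^k (Fin d → F)

/-- coordinates of an element of `GL_d` together with the coordinates of its inverse;
polynomial conditions on these cut out the Zariski closed subsets of `GL_d`. -/
def glCoords (g : GL (Fin d) F) : (Fin d × Fin d) ⊕ (Fin d × Fin d) → F :=
  Sum.elim (fun q => (g : Matrix (Fin d) (Fin d) F) q.1 q.2)
    (fun q => ((g⁻¹ : GL (Fin d) F) : Matrix (Fin d) (Fin d) F) q.1 q.2)

/-- A subset of `GL_d(F)` is Zariski closed if it is the common zero locus of a family of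
polynomials in the matrix entries and the entries of the inverse matrix. -/
def ZariskiClosed (S : Set (GL (Fin d) F)) : Prop :=
  ∃ T : Set (MvPolynomial ((Fin d × Fin d) ⊕ (Fin d × Fin d)) F),
    S = {g | ∀ p ∈ T, MvPolynomial.eval (glCoords g) p = 0}

/-- `SL(V)` as a subgroup of `GL(V)`. -/
def SLsub (F : Type*) [Field F] (d : ℕ) : Subgroup (GL (Fin d) F) where
  carrier := {g | ((g : GL (Fin d) F) : Matrix (Fin d) (Fin d) F).det = 1}
  one_mem' := by simp
  mul_mem' := by
    intro a b ha hb
    simp only [Set.mem_setOf_eq, Units.val_mul, Matrix.det_mul] at *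
    rw [ha, hb, one_mul]
  inv_mem' := by
    intro a ha
    simp only [Set.mem_setOf_eq] at *
    have h : ((a : Matrix (Fin d) (Fin d) F) * ((a⁻¹ : GL (Fin d) F) : Matrix (Fin d) (Fin d) F)).det = 1 := by
      rw [← Units.val_mul, mul_inv_cancel, Units.val_one, Matrix.det_one]
    rw [Matrix.det_mul, ha, one_mul] at h
    exact h

/-- The isometry group of the (possibly `σ`-sesquilinear) form given by the Gram matrix `J`,
as a subgroup of `GL_d`. -/
def isomGroup {R : Type*} [CommRing R] (σ : R →+* R) {d : ℕ}
    (J : Matrix (Fin d) (Fin d) R) : Subgroup (GL (Fin d) R) where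
  carrier := {g | (((g : GL (Fin d) R) : Matrix (Fin d) (Fin d) R).map σ)ᵀ * J *
      ((g : GL (Fin d) R) : Matrix (Fin d) (Fin d) R) = J}
  one_mem' := by
    simp only [Set.mem_setOf_eq, Units.val_one,
      Matrix.map_one σ (map_zero σ) (map_one σ), Matrix.transpose_one, one_mul, mul_one]
  mul_mem' := by
    intro a b ha hb
    simp only [Set.mem_setOf_eq, Units.val_mul] at *
    rw [Matrix.map_mul, Matrix.transpose_mul]
    calc ((b : Matrix (Fin d) (Fin d) R).map σ)ᵀ * ((a : Matrix (Fin d) (Fin d) R).map σ)ᵀ * J *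
          ((a : Matrix (Fin d) (Fin d) R) * (b : Matrix (Fin d) (Fin d) R))
        = ((b : Matrix (Fin d) (Fin d) R).map σ)ᵀ *
            ((((a : Matrix (Fin d) (Fin d) R).map σ)ᵀ * J * (a : Matrix (Fin d) (Fin d) R)) *
            (b : Matrix (Fin d) (Fin d) R)) := by noncomm_ring
      _ = J := by rw [ha, ← mul_assoc, hb]
  inv_mem' := by
    intro a ha
    simp only [Set.mem_setOf_eq] at *
    calc (((a⁻¹ : GL (Fin d) R) : Matrix (Fin d) (Fin d) R).map σ)ᵀ * J *
          ((a⁻¹ : GL (Fin d) R) : Matrix (Fin d) (Fin d) R)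
        = (((a⁻¹ : GL (Fin d) R) : Matrix (Fin d) (Fin d) R).map σ)ᵀ *
            (((a : Matrix (Fin d) (Fin d) R).map σ)ᵀ * J * (a : Matrix (Fin d) (Fin d) R)) *
            ((a⁻¹ : GL (Fin d) R) : Matrix (Fin d) (Fin d) R) := by rw [ha]
      _ = (((a : Matrix (Fin d) (Fin d) R) * ((a⁻¹ : GL (Fin d) R) : Matrix (Fin d) (Fin d) R)).map σ)ᵀ
            * J * ((a : Matrix (Fin d) (Fin d) R) * ((a⁻¹ : GL (Fin d) R) : Matrix (Fin d) (Fin d) R)) := by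
          rw [Matrix.map_mul, Matrix.transpose_mul]; noncomm_ring
      _ = J := by
          rw [← Units.val_mul, mul_inv_cancel, Units.val_one,
            Matrix.map_one σ (map_zero σ) (map_one σ), Matrix.transpose_one, one_mul, mul_one]

/-- a nondegenerate alternating bilinear form (Gram matrix). -/
def IsAltMat {R : Type*} [CommRing R] {d : ℕ} (J : Matrix (Fin d) (Fin d) R) : Prop :=
  IsUnit J ∧ Jᵀ = -J ∧ ∀ i, J i i = 0

/-- a nondegenerate symmetric bilinear form (Gram matrix). -/
def IsSymMat {R : Type*} [CommRing R] {d : ℕ} (J : Matrix (Fin d) (Fin d) R) : Prop :=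
  IsUnit J ∧ Jᵀ = J

/-- the symplectic group of an alternating form `J`. -/
abbrev SpGroup {R : Type*} [CommRing R] {d : ℕ} (J : Matrix (Fin d) (Fin d) R) :
    Subgroup (GL (Fin d) R) := isomGroup (RingHom.id R) J

/-- the full orthogonal group of a symmetric form `J`. -/
abbrev GOGroup {R : Type*} [CommRing R] {d : ℕ} (J : Matrix (Fin d) (Fin d) R) :
    Subgroup (GL (Fin d) R) := isomGroup (RingHom.id R) J

/-- `H` is a normal subgroup of `G` (so in particular `G` normalizes `H`). -/
def NormalIn {Γ : Type*} [Group Γ] (H G : Subgroup Γ) : Prop :=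
  H ≤ G ∧ ∀ g ∈ G, ∀ h ∈ H, g * h * g⁻¹ ∈ H


/-- `O^ℓ(N)`: the smallest normal subgroup of `N` whose quotient is an `ℓ`-group
(`N` itself when `ℓ = 0`). -/
def ellResidual (ℓ : ℕ) (N : Type*) [Group N] : Subgroup N :=
  ⨅ (K : Subgroup N) (_ : K.Normal)
    (_ : ∀ x : N, ∃ n : ℕ, 0 < ℓ ^ n ∧ x ^ ℓ ^ n ∈ K), K

section ExteriorPowers

variable {V : Type*} [AddCommGroup V] [Module F V]

theorem map_ι_pow_eq_map (X : Submodule F V) (k : ℕ) :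
    X.map (ExteriorAlgebra.ι F) ^ k =
      (⋀[F]^k X).map (ExteriorAlgebra.map X.subtype).toLinearMap := by
  rw [Submodule.map_pow, ExteriorAlgebra.ι_range_map_map, Submodule.range_subtype]

theorem map_ι_pow_eq_bot_iff [Module.Finite F V] (X : Submodule F V) (k : ℕ) :
    X.map (ExteriorAlgebra.ι F) ^ k = ⊥ ↔ Module.finrank F X < k := by
  have hinj : Function.Injective (ExteriorAlgebra.map X.subtype).toLinearMap :=
    ExteriorAlgebra.map_injective_field X.ker_subtype
  rw [map_ι_pow_eq_map, ← Nat.choose_eq_zero_iff, ← exteriorPower.finrank_eq F k (M := X),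
    Submodule.finrank_eq_zero, ← Submodule.map_bot (ExteriorAlgebra.map X.subtype).toLinearMap,
    (Submodule.map_injective_of_injective hinj).eq_iff]

theorem map_ι_map (π : V →ₗ[F] V) (U : Submodule F V) (k : ℕ) :
    (U.map (ExteriorAlgebra.ι F) ^ k).map (ExteriorAlgebra.map π).toLinearMap =
      (U.map π).map (ExteriorAlgebra.ι F) ^ k := by
  rw [Submodule.map_pow, ← Submodule.map_comp, ← Submodule.map_comp, ExteriorAlgebra.map_comp_ι]

theorem exteriorPower_eq_map_top (k : ℕ) :
    (⋀[F]^k V) = (⊤ : Submodule F V).map (ExteriorAlgebra.ι F) ^ k := by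
  rw [Submodule.map_top]

theorem ιMulti_ne_zero {m : ℕ} {v : Fin m → V} (hv : LinearIndependent F v) :
    ExteriorAlgebra.ιMulti F m v ≠ 0 := by
  intro h0
  obtain ⟨p, hp⟩ := (Fintype.linearCombination F v).exists_leftInverse_of_injective
    (LinearMap.ker_eq_bot.mpr hv.fintypeLinearCombination_injective)
  have hpv : ∀ i, p (v i) = Pi.single i 1 := fun i => by
    have := LinearMap.congr_fun hp (Pi.single i 1)
    simpa [Fintype.linearCombination_apply_single] using this
  have h1 := ExteriorAlgebra.liftAlternating_apply_ιMulti (R := F) (N := F)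
    (Function.update 0 m (Matrix.detRowAlternating.compLinearMap p)) v
  rw [h0, map_zero, Function.update_self, AlternatingMap.compLinearMap_apply] at h1
  simp only [hpv] at h1
  have h2 : (fun i : Fin m => (Pi.single i 1 : Fin m → F)) = (1 : Matrix (Fin m) (Fin m) F) := by
    ext i j
    simp [Matrix.one_apply, Pi.single_apply, eq_comm]
  rw [h2] at h1
  exact one_ne_zero (Matrix.det_one.symm.trans h1.symm)

theorem exists_linearIndependent_append [Module.Finite F V] {j : ℕ} {w : Fin j → V}
    (hw : LinearIndependent F w) (m : ℕ) (hm : j + m ≤ Module.finrank F V) :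
    ∃ x : Fin m → V, LinearIndependent F (Fin.append w x) := by
  induction m with
  | zero =>
    refine ⟨Fin.elim0, ?_⟩
    rw [Fin.append_right_nil _ _ rfl]
    exact hw
  | succ m ih =>
    obtain ⟨x, hx⟩ := ih (by lia)
    obtain ⟨y, hy⟩ := exists_linearIndependent_snoc_of_lt_finrank hx (by lia)
    exact ⟨Fin.snoc x y, by rw [Fin.append_snoc]; exact hy⟩

/-- The degree-`k` part of the ideal of the exterior algebra generated by `⋀^j U`. -/
def wedgeIdeal (U : Submodule F V) (j k : ℕ) : Submodule F (ExteriorAlgebra F V) :=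
  U.map (ExteriorAlgebra.ι F) ^ j * (⊤ : Submodule F V).map (ExteriorAlgebra.ι F) ^ (k - j)

theorem wedgeIdeal_le (U : Submodule F V) {j k : ℕ} (hjk : j ≤ k) :
    wedgeIdeal U j k ≤ ⋀[F]^k V := by
  rw [exteriorPower_eq_map_top, wedgeIdeal]
  conv_rhs => rw [← Nat.add_sub_cancel' hjk, pow_add]
  gcongr
  exact le_top

theorem wedgeIdeal_map (U : Submodule F V) (j k : ℕ) (π : V →ₗ[F] V) :
    (wedgeIdeal U j k).map (ExteriorAlgebra.map π).toLinearMap ≤ wedgeIdeal (U.map π) j k := by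
  rw [wedgeIdeal, Submodule.map_mul, map_ι_map, map_ι_map, wedgeIdeal]
  gcongr
  exact le_top

theorem ιMulti_mem_map_ι_pow {U : Submodule F V} {m : ℕ} {v : Fin m → V} (hv : ∀ i, v i ∈ U) :
    ExteriorAlgebra.ιMulti F m v ∈ U.map (ExteriorAlgebra.ι F) ^ m := by
  rw [ExteriorAlgebra.ιMulti_apply]
  apply Submodule.pow_subset_pow
  rw [Set.mem_pow]
  exact ⟨fun i => ⟨_, Submodule.mem_map_of_mem (hv i)⟩, rfl⟩

theorem wedgeIdeal_ne_bot [Module.Finite F V] (U : Submodule F V) {j k : ℕ} (hjk : j ≤ k)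
    (hjU : j ≤ Module.finrank F U) (hk : k ≤ Module.finrank F V) : wedgeIdeal U j k ≠ ⊥ := by
  obtain ⟨w, hw⟩ := exists_linearIndependent_of_le_finrank hjU
  obtain ⟨x, hx⟩ := exists_linearIndependent_append (w := fun i => (w i : V))
    (hw.map' U.subtype U.ker_subtype) (k - j) (by lia)
  refine (Submodule.ne_bot_iff _).mpr ⟨_, ?_, ιMulti_ne_zero hx⟩
  rw [← ExteriorAlgebra.ιMulti_mul_ιMulti]
  exact Submodule.mul_mem_mul (ιMulti_mem_map_ι_pow fun i => (w i).2)
    (ιMulti_mem_map_ι_pow fun i => Submodule.mem_top)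

theorem finrank_map_add_finrank_inf_ker [Module.Finite F V] (π : V →ₗ[F] V) (U : Submodule F V) :
    Module.finrank F (U.map π) + Module.finrank F ↥(U ⊓ LinearMap.ker π) = Module.finrank F U := by
  have h := LinearMap.finrank_range_add_finrank_ker (π.domRestrict U)
  rw [LinearMap.range_domRestrict] at h
  rw [← h, ← Submodule.map_comap_subtype, Submodule.finrank_map_subtype_eq]
  rfl

end ExteriorPowers

/-- A `G`-stable family of subspaces of `V`, all of which meet a fixed small subspace `C` in a
large subspace, gives rise to a proper nonzero `G`-submodule of `⋀^k(V)`. -/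
theorem not_extIrreducible_of_family {G : Subgroup (GL (Fin d) F)} {k j : ℕ}
    {𝒰 : Set (Submodule F (Fin d → F))} (hne : 𝒰.Nonempty)
    (hG : ∀ g ∈ G, ∀ U ∈ 𝒰, U.map (g : Matrix (Fin d) (Fin d) F).mulVecLin ∈ 𝒰)
    (hjk : j ≤ k) (hj : ∀ U ∈ 𝒰, j ≤ Module.finrank F U) {C : Submodule F (Fin d → F)}
    (hC : Module.finrank F C + k ≤ d)
    (hCU : ∀ U ∈ 𝒰, Module.finrank F U < j + Module.finrank F ↥(U ⊓ C)) :
    ¬ ExtIrreducible G k := by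
  rintro ⟨-, hirr⟩
  set K : Submodule F (ExteriorAlgebra F (Fin d → F)) := ⨆ U ∈ 𝒰, wedgeIdeal U j k with hK
  have hKG : ExtInvariant G K := by
    intro g hg v hv
    have : K ≤ K.comap (extSubst (g : Matrix (Fin d) (Fin d) F)).toLinearMap := by
      refine iSup₂_le fun U hU => ?_
      rw [← Submodule.map_le_iff_le_comap]
      exact (wedgeIdeal_map U j k _).trans
        (le_iSup₂_of_le (f := fun U _ => wedgeIdeal U j k) _ (hG g hg U hU) le_rfl)
    exact this hv
  rcases hirr K (iSup₂_le fun U _ => wedgeIdeal_le U hjk) hKG with h | h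
  · obtain ⟨U, hU⟩ := hne
    refine wedgeIdeal_ne_bot U hjk (hj U hU) (by simp; lia) (le_bot_iff.mp ?_)
    rw [← h]
    exact le_iSup₂_of_le U hU le_rfl
  · obtain ⟨D, hD⟩ := C.exists_isCompl
    set π := D.projection C hD.symm with hπ
    have hker : LinearMap.ker π = C := Submodule.ker_projection _
    have h0 : K.map (ExteriorAlgebra.map π).toLinearMap = ⊥ := by
      rw [hK, Submodule.map_iSup, eq_bot_iff]
      refine iSup_le fun U => ?_
      rw [Submodule.map_iSup]
      refine iSup_le fun hU => (wedgeIdeal_map U j k π).trans ?_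
      have h1 : (U.map π).map (ExteriorAlgebra.ι F) ^ j = ⊥ := by
        rw [map_ι_pow_eq_bot_iff]
        have h2 := finrank_map_add_finrank_inf_ker π U
        have h3 := hCU U hU
        rw [hker] at h2
        lia
      rw [wedgeIdeal, h1, Submodule.bot_mul]
    rw [h, exteriorPower_eq_map_top, map_ι_map, map_ι_pow_eq_bot_iff] at h0
    have h2 := finrank_map_add_finrank_inf_ker π ⊤
    rw [hker, top_inf_eq, finrank_top, Module.finrank_fin_fun] at h2
    lia

theorem exists_le_finrank_eq {V : Type*} [AddCommGroup V] [Module F V] [Module.Finite F V]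
    (U : Submodule F V) {m : ℕ} (hm : m ≤ Module.finrank F U) :
    ∃ C ≤ U, Module.finrank F C = m := by
  obtain ⟨w, hw⟩ := exists_linearIndependent_of_le_finrank hm
  refine ⟨(Submodule.span F (Set.range w)).map U.subtype, Submodule.map_subtype_le _ _, ?_⟩
  rw [Submodule.finrank_map_subtype_eq, finrank_span_eq_card hw, Fintype.card_fin]

theorem ExtIrreducible.eq_bot_or_eq_top {G : Subgroup (GL (Fin d) F)} {k : ℕ}
    (h : ExtIrreducible G k) (hk : 1 ≤ k) (hkd : k + 1 ≤ d) (U : Submodule F (Fin d → F))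
    (hU : ∀ g ∈ G, U.map (g : Matrix (Fin d) (Fin d) F).mulVecLin = U) : U = ⊥ ∨ U = ⊤ := by
  by_contra! hcon
  have h1 : Module.finrank F U ≠ 0 := by simpa [Submodule.finrank_eq_zero] using hcon.1
  have h2 : Module.finrank F U < d := by
    simpa using Submodule.finrank_lt hcon.2
  obtain ⟨C, hCU, hC⟩ := exists_le_finrank_eq U
    (m := Module.finrank F U + 1 - min (Module.finrank F U) k) (by lia)
  refine not_extIrreducible_of_family (𝒰 := {U}) (j := min (Module.finrank F U) k) (C := C)
    (Set.singleton_nonempty _) ?_ (by lia) ?_ (by lia) ?_ h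
  · rintro g hg _ rfl
    exact hU g hg
  · rintro _ rfl
    lia
  · rintro _ rfl
    rw [inf_eq_right.mpr hCU]
    lia

section UniformRank

open Module

variable {R V : Type*} [Ring R] [Algebra F R] [AddCommGroup V] [Module F V] [Module R V]
  [IsScalarTower F R V]

theorem exists_finrank_range_eq {V : Type*} [AddCommGroup V] [Module F V] [Module.Finite F V]
    {q : ℕ} (hq : q ≤ finrank F V) : ∃ A : V →ₗ[F] V, finrank F (LinearMap.range A) = q := by
  obtain ⟨C, -, hC⟩ := exists_le_finrank_eq (⊤ : Submodule F V) (m := q) (by simpa using hq)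
  obtain ⟨p, hp⟩ := C.subtype.exists_leftInverse_of_injective C.ker_subtype
  refine ⟨C.subtype ∘ₗ p, ?_⟩
  have hp' : LinearMap.range p = ⊤ :=
    LinearMap.range_eq_top.mpr fun x => ⟨x, LinearMap.congr_fun hp x⟩
  rw [LinearMap.range_comp, hp', Submodule.map_top, Submodule.range_subtype, hC]

theorem exists_smul_of_isSimpleModule [IsAlgClosed F] [Module.Finite F V] [IsSimpleModule R V]
    (f : V →ₗ[R] V) : ∃ c : F, ∀ x, f x = c • x := by
  obtain ⟨c, hc⟩ := (IsSimpleModule.algebraMap_end_bijective_of_isAlgClosed (A := R) (V := V) F).2 f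
  exact ⟨c, fun x => by rw [← hc]; rfl⟩

/-- The transport of an `F`-linear endomorphism along an `R`-linear isomorphism. -/
def transport {S T : Type*} [AddCommGroup S] [Module F S] [Module R S] [IsScalarTower F R S]
    [AddCommGroup T] [Module F T] [Module R T] [IsScalarTower F R T]
    (θ : S ≃ₗ[R] T) (A : T →ₗ[F] T) : S →ₗ[F] S :=
  (θ.symm.restrictScalars F).toLinearMap ∘ₗ A ∘ₗ (θ.restrictScalars F).toLinearMap

theorem transport_apply {S T : Type*} [AddCommGroup S] [Module F S] [Module R S]
    [IsScalarTower F R S] [AddCommGroup T] [Module F T] [Module R T] [IsScalarTower F R T]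
    (θ : S ≃ₗ[R] T) (A : T →ₗ[F] T) (x : S) : transport θ A x = θ.symm (A (θ x)) := rfl

theorem finrank_range_transport {S T : Type*} [AddCommGroup S] [Module F S] [Module R S]
    [IsScalarTower F R S] [AddCommGroup T] [Module F T] [Module R T] [IsScalarTower F R T]
    (θ : S ≃ₗ[R] T) (A : T →ₗ[F] T) :
    finrank F (LinearMap.range (transport θ A)) = finrank F (LinearMap.range A) := by
  rw [transport, LinearMap.range_comp, LinearMap.range_comp_of_range_eq_top]
  · exact LinearEquiv.finrank_map_eq (θ.symm.restrictScalars F) _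
  · exact LinearEquiv.range _

theorem transport_intertwines [IsAlgClosed F] {S S' T : Type*}
    [AddCommGroup S] [Module F S] [Module R S] [IsScalarTower F R S]
    [AddCommGroup S'] [Module F S'] [Module R S'] [IsScalarTower F R S']
    [AddCommGroup T] [Module F T] [Module R T] [IsScalarTower F R T]
    [Module.Finite F T] [IsSimpleModule R T]
    (θ : S ≃ₗ[R] T) (θ' : S' ≃ₗ[R] T) (A : T →ₗ[F] T) (h : S →ₗ[R] S') (x : S) :
    transport θ' A (h x) = h (transport θ A x) := by
  obtain ⟨c, hc⟩ := exists_smul_of_isSimpleModule (F := F)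
    (θ'.toLinearMap ∘ₗ h ∘ₗ θ.symm.toLinearMap)
  have h1 : ∀ y, h (θ.symm y) = c • θ'.symm y := fun y => by
    have := hc y
    simp only [LinearMap.comp_apply, LinearEquiv.coe_coe] at this
    rw [← LinearEquiv.symm_apply_apply θ' (h (θ.symm y)), this]
    exact (θ'.symm.restrictScalars F).map_smul c y
  have h2 : θ' (h x) = c • θ x := by
    have := hc (θ x)
    simpa using this
  rw [transport_apply, transport_apply, h1, h2, map_smul]
  exact (θ'.symm.restrictScalars F).map_smul c _

theorem exists_intertwining_family [IsAlgClosed F] {n e q : ℕ} (hq : q ≤ e)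
    (S : Fin n → Submodule R V) [Module.Finite F V] (hS : ∀ i, IsSimpleModule R (S i))
    (he : ∀ i, finrank F (S i) = e) :
    ∃ π : ∀ i, S i →ₗ[F] S i, (∀ i, finrank F (LinearMap.range (π i)) = q) ∧
      ∀ i j (h : S i →ₗ[R] S j) (x : S i), π j (h x) = h (π i x) := by
  have fin : ∀ i, Module.Finite F (S i) := fun i =>
    inferInstanceAs (Module.Finite F ((S i).restrictScalars F))
  choose A hA using fun i => exists_finrank_range_eq (V := S i) (q := q) (by rw [he]; exact hq)
  let s : Setoid (Fin n) :=
    { r := fun i j => Nonempty (S i ≃ₗ[R] S j)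
      iseqv := ⟨fun _ => ⟨LinearEquiv.refl _ _⟩, fun ⟨f⟩ => ⟨f.symm⟩,
        fun ⟨f⟩ ⟨g⟩ => ⟨f.trans g⟩⟩ }
  let t : Fin n → Fin n := fun i => (Quotient.mk s i).out
  have ht : ∀ i, Nonempty (S i ≃ₗ[R] S (t i)) := fun i =>
    s.iseqv.symm (Quotient.mk_out (s := s) i)
  let θ := fun i => (ht i).some
  refine ⟨fun i => transport (θ i) (A (t i)), fun i => ?_, fun i j h x => ?_⟩
  · rw [finrank_range_transport, hA]
  · rcases LinearMap.bijective_or_eq_zero h with hb | h0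
    · have key : ∀ a b (_ : a = b) (α : S i ≃ₗ[R] S a) (β : S j ≃ₗ[R] S b),
          transport β (A b) (h x) = h (transport α (A a) x) := by
        rintro a _ rfl α β
        exact transport_intertwines α β (A a) h x
      refine key _ _ ?_ _ _
      exact congrArg Quotient.out (Quotient.sound (s := s) ⟨LinearEquiv.ofBijective h hb⟩)
    · simp [h0]

/-- A semisimple module all of whose simple submodules have dimension `e` carries, for each
`q ≤ e`, a linear operator commuting with all endomorphisms and of rank `q` on each simple
submodule. -/
theorem exists_uniform_rank [IsAlgClosed F] [Module.Finite F V] [IsSemisimpleModule R V]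
    {e q : ℕ} (he : ∀ U : Submodule R V, IsSimpleModule R U → finrank F U = e) (hq : q ≤ e) :
    ∃ (n : ℕ) (z : V →ₗ[F] V), n * e = finrank F V ∧ n * q ≤ finrank F (LinearMap.range z) ∧
      (∀ (f : V →ₗ[R] V) (v : V), z (f v) = f (z v)) ∧
      ∀ U : Submodule R V, IsSimpleModule R U →
        finrank F ((U.restrictScalars F).map z) = q := by
  have : Module.Finite R V := Module.Finite.of_restrictScalars_finite F R V
  obtain ⟨n, S, ε', hS⟩ := IsSemisimpleModule.exists_linearEquiv_fin_dfinsupp R V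
  let ε : V ≃ₗ[R] ∀ i, S i := ε'.trans DFinsupp.linearEquivFunOnFintype
  have fin : ∀ i, Module.Finite F (S i) := fun i =>
    inferInstanceAs (Module.Finite F ((S i).restrictScalars F))
  obtain ⟨π, hπ, hcomm⟩ := exists_intertwining_family hq S hS fun i => he _ (hS i)
  let P : (∀ i, S i) →ₗ[F] ∀ i, S i := LinearMap.pi fun i => π i ∘ₗ LinearMap.proj i
  let z : V →ₗ[F] V := transport ε P
  have hz : ∀ v i, ε (z v) i = π i (ε v i) := fun v i => by
    change ε (ε.symm (P (ε v))) i = _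
    rw [LinearEquiv.apply_symm_apply]; rfl
  have hsum : ∀ w : ∀ i, S i, w = ∑ i, LinearMap.single R (fun i => S i) i (w i) := fun w => by
    simp [LinearMap.single_apply, Finset.univ_sum_single]
  have hom : ∀ i (h : S i →ₗ[R] V) (x : S i), z (h x) = h (π i x) := fun i h x => by
    apply ε.injective
    funext j
    rw [hz]
    exact hcomm i j (LinearMap.proj j ∘ₗ ε.toLinearMap ∘ₗ h) x
  refine ⟨n, z, ?_, ?_, fun f v => ?_, fun U hU => ?_⟩
  · rw [(ε.restrictScalars F).finrank_eq, Module.finrank_pi_fintype F]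
    simp [he _ (hS _)]
  · rw [finrank_range_transport]
    have hinj : Function.Injective (LinearMap.pi fun i =>
        (LinearMap.range (π i)).subtype ∘ₗ LinearMap.proj i :
          (∀ i, LinearMap.range (π i)) →ₗ[F] ∀ i, S i) := fun a b hab => by
      funext i
      exact Subtype.ext (congrFun hab i)
    have hle := LinearMap.finrank_range_of_inj hinj
    rw [Module.finrank_pi_fintype F] at hle
    simp only [hπ, Finset.sum_const, Finset.card_univ, Fintype.card_fin, smul_eq_mul] at hle
    rw [← hle]
    apply Submodule.finrank_mono
    rintro _ ⟨a, rfl⟩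
    choose b hb using fun i => (a i).2
    exact ⟨b, funext hb⟩
  · have hv := hsum (ε v)
    have hv' : v = ∑ i, ε.symm (LinearMap.single R (fun i => S i) i (ε v i)) := by
      rw [← map_sum, ← hv, LinearEquiv.symm_apply_apply]
    rw [hv']
    simp only [map_sum]
    refine Finset.sum_congr rfl fun i _ => ?_
    have h1 := hom i (f ∘ₗ ε.symm.toLinearMap ∘ₗ LinearMap.single R (fun i => S i) i) (ε v i)
    have h2 := hom i (ε.symm.toLinearMap ∘ₗ LinearMap.single R (fun i => S i) i) (ε v i)
    simp only [LinearMap.comp_apply, LinearEquiv.coe_coe] at h1 h2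
    rw [h1, h2]
  · obtain ⟨i, hi⟩ : ∃ i, (LinearMap.proj i ∘ₗ ε.toLinearMap ∘ₗ U.subtype : U →ₗ[R] S i) ≠ 0 := by
      by_contra! h0
      have := IsSimpleModule.nontrivial R U
      obtain ⟨u, hu⟩ := exists_ne (0 : U)
      refine hu (Subtype.ext (ε.injective (funext fun i => ?_)))
      simpa using LinearMap.congr_fun (h0 i) u
    let θ : S i ≃ₗ[R] U := (LinearEquiv.ofBijective _ (LinearMap.bijective_of_ne_zero hi)).symm
    have : (U.restrictScalars F).map z = (LinearMap.range (π i)).map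
        ((U.subtype ∘ₗ θ.toLinearMap).restrictScalars F) := by
      ext y
      constructor
      · rintro ⟨u, hu, rfl⟩
        refine ⟨π i (θ.symm ⟨u, hu⟩), ⟨_, rfl⟩, ?_⟩
        rw [LinearMap.restrictScalars_apply, ← hom]
        simp
      · rintro ⟨_, ⟨x, rfl⟩, rfl⟩
        rw [LinearMap.restrictScalars_apply, ← hom]
        exact ⟨_, (θ x).2, rfl⟩
    have hθ : Function.Injective ((U.subtype ∘ₗ θ.toLinearMap).restrictScalars F) :=
      Subtype.val_injective.comp θ.injective
    rw [this, ← (Submodule.equivMapOfInjective _ hθ _).finrank_eq, hπ]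

end UniformRank

section Clifford

open Module

variable {V : Type*} [AddCommGroup V] [Module F V]

/-- An `F`-linear automorphism normalizing `R` permutes the `R`-submodules. -/
def twist (R : Subalgebra F (End F V)) (u : V ≃ₗ[F] V)
    (hu : ∀ r ∈ R, u.symm.toLinearMap ∘ₗ r ∘ₗ u.toLinearMap ∈ R) (W : Submodule R V) :
    Submodule R V where
  __ := ((W.restrictScalars F).map u.toLinearMap).toAddSubmonoid
  smul_mem' := by
    rintro r _ ⟨w, hw, rfl⟩
    refine ⟨_, W.smul_mem ⟨_, hu r r.2⟩ hw, ?_⟩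
    exact u.apply_symm_apply _

theorem mem_twist {R : Subalgebra F (End F V)} {u : V ≃ₗ[F] V}
    {hu : ∀ r ∈ R, u.symm.toLinearMap ∘ₗ r ∘ₗ u.toLinearMap ∈ R} {W : Submodule R V} {x : V} :
    x ∈ twist R u hu W ↔ u.symm x ∈ W := by
  constructor
  · rintro ⟨w, hw, rfl⟩
    simpa using hw
  · exact fun h => ⟨_, h, u.apply_symm_apply x⟩

/-- `twist` as an automorphism of the lattice of submodules. -/
def twistIso (R : Subalgebra F (End F V)) (u : V ≃ₗ[F] V)
    (hu : ∀ r ∈ R, u.symm.toLinearMap ∘ₗ r ∘ₗ u.toLinearMap ∈ R)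
    (hu' : ∀ r ∈ R, u.toLinearMap ∘ₗ r ∘ₗ u.symm.toLinearMap ∈ R) :
    Submodule R V ≃o Submodule R V where
  toFun := twist R u hu
  invFun := twist R u.symm hu'
  left_inv W := by ext; simp [mem_twist]
  right_inv W := by ext; simp [mem_twist]
  map_rel_iff' {W W'} := by
    refine ⟨fun h x hx => ?_, fun h x hx => ?_⟩
    · have : u x ∈ twist R u hu W' :=
        h (mem_twist (hu := hu).mpr (by simpa using hx))
      simpa using mem_twist.mp this
    · have hx' : x ∈ twist R u hu W := hx
      exact mem_twist (hu := hu).mpr (h (mem_twist.mp hx'))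

theorem finrank_twist {R : Subalgebra F (End F V)} {u : V ≃ₗ[F] V}
    {hu : ∀ r ∈ R, u.symm.toLinearMap ∘ₗ r ∘ₗ u.toLinearMap ∈ R} {W : Submodule R V} :
    finrank F (twist R u hu W) = finrank F W :=
  u.finrank_map_eq (W.restrictScalars F)

theorem exists_isSimpleModule [Module.Finite F V] [Nontrivial V] (R : Type*) [Ring R]
    [Algebra F R] [Module R V] [IsScalarTower F R V] : ∃ W : Submodule R V, IsSimpleModule R W := by
  have : IsArtinian R V := isArtinian_of_tower F inferInstance
  obtain ⟨W, hW⟩ := IsAtomic.exists_atom (Submodule R V)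
  exact ⟨W, isSimpleModule_iff_isAtom.mpr hW⟩

theorem isSemisimpleModule_of_iSup_eq_top {R : Type*} [Ring R] [Algebra F R] [Module R V]
    [IsScalarTower F R V] {ι : Type*} {T : ι → Submodule R V}
    (hT : ∀ i, IsSimpleModule R (T i)) (htop : (⨆ i, T i) = ⊤) {e : ℕ}
    (he : ∀ i, finrank F (T i) = e) :
    IsSemisimpleModule R V ∧
      ∃ e, ∀ U : Submodule R V, IsSimpleModule R U → finrank F U = e := by
  have hss : IsSemisimpleModule R V := by
    refine IsSemisimpleModule.of_sSup_simples_eq_top (le_antisymm le_top ?_)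
    rw [← htop]
    exact iSup_le fun g => le_sSup (hT g)
  refine ⟨hss, e, fun U hU => ?_⟩
  obtain ⟨U', hU'⟩ := exists_isCompl U
  obtain ⟨g, hg⟩ : ∃ g, U.projectionOnto U' hU' ∘ₗ (T g).subtype ≠ 0 := by
    by_contra! h0
    have : (⨆ g, T g) ≤ LinearMap.ker (U.projectionOnto U' hU') := iSup_le fun g x hx =>
      LinearMap.congr_fun (h0 g) ⟨x, hx⟩
    rw [htop, top_le_iff, Submodule.ker_projectionOnto] at this
    rw [this] at hU'
    exact (isSimpleModule_iff_isAtom.mp hU).1 (disjoint_top.mp hU'.disjoint)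
  have hgT := hT g
  let θ : T g ≃ₗ[R] U := LinearEquiv.ofBijective _ (LinearMap.bijective_of_ne_zero hg)
  rw [← (θ.restrictScalars F).finrank_eq, he]

/-- Clifford's theorem for an algebra normalized by a group `Γ` acting irreducibly. -/
theorem isSemisimpleModule_of_normalized [Module.Finite F V] [Nontrivial V]
    (R : Subalgebra F (End F V)) (Γ : Subgroup (V ≃ₗ[F] V))
    (hΓ : ∀ u ∈ Γ, ∀ r ∈ R, u.symm.toLinearMap ∘ₗ r ∘ₗ u.toLinearMap ∈ R)
    (hirr : ∀ U : Submodule F V, (∀ u ∈ Γ, U.map u.toLinearMap = U) → U = ⊥ ∨ U = ⊤) :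
    IsSemisimpleModule R V ∧
      ∃ e, ∀ U : Submodule R V, IsSimpleModule R U → finrank F U = e := by
  obtain ⟨W, hW⟩ := exists_isSimpleModule R (F := F) (V := V)
  have hΓ' : ∀ u ∈ Γ, ∀ r ∈ R, u.toLinearMap ∘ₗ r ∘ₗ u.symm.toLinearMap ∈ R :=
    fun u hu => hΓ _ (Γ.inv_mem hu)
  let T : Γ → Submodule R V := fun u => twist R u.1 (hΓ _ u.2) W
  have hT : ∀ u, IsSimpleModule R (T u) := fun u => isSimpleModule_iff_isAtom.mpr <|
    ((twistIso R u.1 (hΓ _ u.2) (hΓ' _ u.2)).isAtom_iff W).mpr (isSimpleModule_iff_isAtom.mp hW)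
  have hle : ∀ u (hu : u ∈ Γ), twist R u (hΓ _ hu) (⨆ g, T g) ≤ ⨆ g, T g := fun u hu => by
    change twistIso R u (hΓ _ hu) (hΓ' _ hu) _ ≤ _
    rw [OrderIso.map_iSup]
    refine iSup_le fun g => le_trans ?_ (le_iSup T (⟨u, hu⟩ * g))
    intro x hx
    have hx' : x ∈ twist R u (hΓ _ hu) (twist R g.1 (hΓ _ g.2) W) := hx
    rw [mem_twist, mem_twist] at hx'
    exact mem_twist.mpr hx'
  have htop : (⨆ g, T g) = ⊤ := by
    have hinv : ∀ u ∈ Γ, ((⨆ g, T g).restrictScalars F).map u.toLinearMap =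
        (⨆ g, T g).restrictScalars F := fun u hu => by
      refine le_antisymm (hle u hu) fun x hx => ?_
      exact ⟨u.symm x, hle u⁻¹ (Γ.inv_mem hu) ⟨x, hx, rfl⟩, u.apply_symm_apply x⟩
    rcases hirr _ hinv with h | h
    · have h1 : T 1 ≤ ⊥ := by
        rw [← (Submodule.restrictScalars_eq_bot_iff F R V).mp h]
        exact le_iSup T 1
      exact absurd (le_bot_iff.mp h1) (isSimpleModule_iff_isAtom.mp (hT 1)).1
    · exact (Submodule.restrictScalars_eq_top_iff F R V).mp h
  exact isSemisimpleModule_of_iSup_eq_top hT htop fun g => finrank_twist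

theorem not_extIrreducible_of_homogeneous [IsAlgClosed F] {G : Subgroup (GL (Fin d) F)}
    {R : Type*} [Ring R] [Algebra F R] [Module R (Fin d → F)] [IsScalarTower F R (Fin d → F)]
    (hR : ∀ g ∈ G, ∃ T : Submodule R (Fin d → F) ≃o Submodule R (Fin d → F), ∀ U,
      (T U).restrictScalars F =
        (U.restrictScalars F).map (g : Matrix (Fin d) (Fin d) F).mulVecLin)
    [IsSemisimpleModule R (Fin d → F)] {e : ℕ}
    (he : ∀ U : Submodule R (Fin d → F), IsSimpleModule R U → finrank F U = e)
    (he2 : 2 ≤ e) (hed : e < d) {k : ℕ} (hk : 2 ≤ k) (hkd : k + 2 ≤ d) :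
    ¬ ExtIrreducible G k := by
  have : Nonempty (Fin d) := ⟨⟨0, by lia⟩⟩
  obtain ⟨W, hW⟩ := exists_isSimpleModule R (F := F) (V := Fin d → F)
  by_cases hkr : k ≤ d / e * (e - 1)
  · obtain ⟨n, z, hn, hz, -, hzU⟩ := exists_uniform_rank (F := F) he
      (q := min e k - 1) (by lia)
    rw [finrank_fin_fun] at hn
    have hn' : d / e = n := by rw [← hn]; exact Nat.mul_div_cancel _ (by lia)
    rw [hn'] at hkr
    have hn2 : 2 ≤ n := by by_contra! h; interval_cases n <;> lia
    have hkn : k ≤ n * (min e k - 1) := by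
      rcases le_total e k with h | h
      · rwa [min_eq_left h]
      · rw [min_eq_right h]
        have : 2 * (k - 1) ≤ n * (k - 1) := Nat.mul_le_mul_right _ hn2
        lia
    refine not_extIrreducible_of_family
      (𝒰 := {X | ∃ U : Submodule R (Fin d → F), IsSimpleModule R U ∧ U.restrictScalars F = X})
      (j := min e k) (C := LinearMap.ker z) ⟨_, W, hW, rfl⟩ ?_ (min_le_right _ _) ?_ ?_ ?_
    · rintro g hg _ ⟨U, hU, rfl⟩
      obtain ⟨T, hT⟩ := hR g hg
      refine ⟨T U, ?_, hT U⟩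
      rw [isSimpleModule_iff_isAtom] at hU ⊢
      exact (T.isAtom_iff U).mpr hU
    · rintro _ ⟨U, hU, rfl⟩
      exact (min_le_left _ _).trans (he U hU).ge
    · have := z.finrank_range_add_finrank_ker
      rw [finrank_fin_fun] at this
      lia
    · rintro _ ⟨U, hU, rfl⟩
      have h3 := finrank_map_add_finrank_inf_ker z (U.restrictScalars F)
      rw [hzU U hU] at h3
      have h4 : finrank F (U.restrictScalars F) = e := he U hU
      lia
  · obtain ⟨n, z, hn, hz, hzc, hzU⟩ := exists_uniform_rank (F := F) he
      (q := min e (d - k) - 1) (by lia)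
    rw [finrank_fin_fun] at hn
    have hn' : d / e = n := by rw [← hn]; exact Nat.mul_div_cancel _ (by lia)
    rw [hn', Nat.mul_sub, mul_one, hn] at hkr
    have hmn : d - k ≤ n * (min e (d - k) - 1) := by
      have : n * 1 ≤ n * (min e (d - k) - 1) := Nat.mul_le_mul_left _ (by lia)
      lia
    obtain ⟨C, hCz, hC⟩ := exists_le_finrank_eq (LinearMap.range z) (hmn.trans hz)
    have hU : ∀ U : Submodule R (Fin d → F), IsCoatom U → finrank F U = d - e ∧
        d - k - (min e (d - k) - 1) ≤ finrank F ↥(U.restrictScalars F ⊓ C) := fun U hU => by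
      obtain ⟨W, hW⟩ := exists_isCompl U
      have hWs : IsSimpleModule R W :=
        isSimpleModule_iff_isAtom.mpr (hW.isCoatom_iff_isAtom.mp hU)
      let p := W.projection U hW.symm
      have hpk : LinearMap.ker p = U := Submodule.ker_projection _
      have hpr : LinearMap.range p = W := Submodule.range_projection _
      constructor
      · have := (p.restrictScalars F).finrank_range_add_finrank_ker
        rw [finrank_fin_fun] at this
        have h5 : LinearMap.ker (p.restrictScalars F) = U.restrictScalars F := by
          rw [← hpk]; rfl
        have h6 : LinearMap.range (p.restrictScalars F) = W.restrictScalars F := by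
          rw [← hpr]; rfl
        rw [h5, h6] at this
        have h7 : finrank F (W.restrictScalars F) = e := he W hWs
        have h8 : finrank F (U.restrictScalars F) = finrank F U := rfl
        lia
      · have h3 := finrank_map_add_finrank_inf_ker (p.restrictScalars F) C
        have h5 : LinearMap.ker (p.restrictScalars F) = U.restrictScalars F := by
          rw [← hpk]; rfl
        rw [h5, hC, inf_comm] at h3
        have h6 : C.map (p.restrictScalars F) ≤ (W.restrictScalars F).map z := by
          rintro _ ⟨c, hc, rfl⟩
          obtain ⟨v, rfl⟩ := hCz hc
          refine ⟨p v, ?_, hzc p v⟩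
          rw [← hpr]
          exact ⟨v, rfl⟩
        have h7 := Submodule.finrank_mono h6
        rw [hzU W hWs] at h7
        lia
    refine not_extIrreducible_of_family
      (𝒰 := {X | ∃ U : Submodule R (Fin d → F), IsCoatom U ∧ U.restrictScalars F = X})
      (j := min (d - e) k) (C := C) ?_ ?_ (min_le_right _ _) ?_ ?_ ?_
    · obtain ⟨U, hWU⟩ := exists_isCompl W
      exact ⟨_, U, hWU.isAtom_iff_isCoatom.mp (isSimpleModule_iff_isAtom.mp hW), rfl⟩
    · rintro g hg _ ⟨U, hU, rfl⟩
      obtain ⟨T, hT⟩ := hR g hg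
      exact ⟨T U, (T.isCoatom_iff U).mpr hU, hT U⟩
    · rintro _ ⟨X, hX, rfl⟩
      exact (min_le_left _ _).trans (hU X hX).1.ge
    · lia
    · rintro _ ⟨X, hX, rfl⟩
      have h4 : finrank F (X.restrictScalars F) = d - e := (hU X hX).1
      have := (hU X hX).2
      lia

theorem commute_of_finrank_simple_le_one {R : Type*} [Ring R] [Algebra F R] [Module R V]
    [IsScalarTower F R V] [Module.Finite F V] [IsSemisimpleModule R V]
    (he : ∀ U : Submodule R V, IsSimpleModule R U → finrank F U ≤ 1) (a b : R) (x : V) :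
    a • b • x = b • a • x := by
  have hx : x ∈ sSup {m : Submodule R V | IsSimpleModule R m} := by
    rw [sSup_simples_eq_top_iff_isSemisimpleModule.mpr inferInstance]
    trivial
  rw [sSup_eq_iSup'] at hx
  induction hx using Submodule.iSup_induction' with
  | zero => simp
  | add y z _ _ hy hz => simp only [smul_add, hy, hz]
  | mem U y hy =>
    have hfin : Module.Finite F U.1 := inferInstanceAs (Module.Finite F (U.1.restrictScalars F))
    obtain ⟨v, hv⟩ := finrank_le_one_iff.mp (he U.1 U.2)
    have hsc : ∀ r : R, ∃ c : F, ∀ w ∈ U.1, r • w = c • w := fun r => by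
      obtain ⟨c, hc⟩ := hv (r • v)
      refine ⟨c, fun w hw => ?_⟩
      obtain ⟨t, ht⟩ := hv ⟨w, hw⟩
      have hw' : w = t • (v : V) := congrArg Subtype.val ht.symm
      have hc' : c • (v : V) = r • (v : V) := congrArg Subtype.val hc
      rw [hw', ← algebraMap_smul R t (v : V), smul_smul, ← Algebra.commutes, ← smul_smul, ← hc',
        algebraMap_smul, algebraMap_smul, smul_comm]
    obtain ⟨α, hα⟩ := hsc a
    obtain ⟨β, hβ⟩ := hsc b
    rw [hα _ (U.1.smul_mem b hy), hβ _ (U.1.smul_mem a hy), hα y hy, hβ y hy, smul_comm]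

theorem commute_apply_of_finrank_simple_le_one [Module.Finite F V] {R : Subalgebra F (End F V)}
    [IsSemisimpleModule R V] (he : ∀ U : Submodule R V, IsSimpleModule R U → finrank F U ≤ 1)
    {a b : End F V} (ha : a ∈ R) (hb : b ∈ R) (x : V) : a (b x) = b (a x) :=
  commute_of_finrank_simple_le_one he (⟨a, ha⟩ : R) ⟨b, hb⟩ x

theorem isSimpleModule_of_top {R M : Type*} [Ring R] [AddCommGroup M] [Module R M]
    (_ : IsSimpleModule R (⊤ : Submodule R M)) : IsSimpleModule R M :=
  IsSimpleModule.congr Submodule.topEquiv.symm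

theorem eq_smul_one_of_simple_finrank_ge [IsAlgClosed F] [Module.Finite F V]
    {R : Subalgebra F (End F V)} {W : Submodule R V} (hW : IsSimpleModule R W)
    (hfin : finrank F V ≤ finrank F W) {c : End F V} (hc : ∀ r ∈ R, c * r = r * c) :
    ∃ t : F, c = t • (1 : End F V) := by
  have hWtop : W = ⊤ := by
    rw [← Submodule.restrictScalars_eq_top_iff F]
    exact Submodule.eq_top_of_finrank_eq (le_antisymm (Submodule.finrank_le _) hfin)
  subst hWtop
  have hV : IsSimpleModule R V := isSimpleModule_of_top hW
  let f : V →ₗ[R] V := { c with map_smul' := fun r x => LinearMap.congr_fun (hc r r.2) x }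
  obtain ⟨t, ht⟩ := exists_smul_of_isSimpleModule (F := F) f
  exact ⟨t, LinearMap.ext ht⟩

/-- The linear span of a matrix group, as an algebra of endomorphisms. -/
def envelope (N : Subgroup (GL (Fin d) F)) : Subalgebra F (End F (Fin d → F)) :=
  Algebra.adjoin F {f | ∃ n ∈ N, f = (n : Matrix (Fin d) (Fin d) F).mulVecLin}

theorem mulVecLin_mem_envelope {N : Subgroup (GL (Fin d) F)} {n : GL (Fin d) F} (hn : n ∈ N) :
    (n : Matrix (Fin d) (Fin d) F).mulVecLin ∈ envelope N :=
  Algebra.subset_adjoin ⟨n, hn, rfl⟩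

/-- Invertible matrices as linear automorphisms. -/
def glEquiv : GL (Fin d) F ≃* ((Fin d → F) ≃ₗ[F] (Fin d → F)) :=
  GeneralLinearGroup.toLin.trans (LinearMap.GeneralLinearGroup.generalLinearEquiv F _)

theorem coe_glEquiv (g : GL (Fin d) F) :
    (glEquiv g).toLinearMap = (g : Matrix (Fin d) (Fin d) F).mulVecLin := rfl

theorem coe_glEquiv_symm (g : GL (Fin d) F) :
    (glEquiv g).symm.toLinearMap =
      ((g⁻¹ : GL (Fin d) F) : Matrix (Fin d) (Fin d) F).mulVecLin := rfl

theorem conj_mem_envelope {G N : Subgroup (GL (Fin d) F)} (hNG : NormalIn N G) {g : GL (Fin d) F}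
    (hg : g ∈ G) {r : End F (Fin d → F)} (hr : r ∈ envelope N) :
    (glEquiv g).symm.toLinearMap ∘ₗ r ∘ₗ (glEquiv g).toLinearMap ∈ envelope N := by
  let u := glEquiv g
  induction hr using Algebra.adjoin_induction with
  | mem x hx =>
    obtain ⟨n, hn, rfl⟩ := hx
    have h := hNG.2 g⁻¹ (G.inv_mem hg) n hn
    rw [inv_inv] at h
    have := mulVecLin_mem_envelope h
    rw [Units.val_mul, Units.val_mul, Matrix.mulVecLin_mul, Matrix.mulVecLin_mul] at this
    exact this
  | algebraMap c =>
    convert (envelope N).algebraMap_mem c using 1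
    refine LinearMap.ext fun x => ?_
    simp [Module.algebraMap_end_apply]
  | add x y _ _ hx hy =>
    rw [LinearMap.add_comp, LinearMap.comp_add]
    exact add_mem hx hy
  | mul x y _ _ hx hy =>
    convert mul_mem hx hy using 1
    refine LinearMap.ext fun x => ?_
    simp

/-- If an exterior power is irreducible over `G` then the nonabelian normal subgroup `N` has only
scalar centralizer. -/
theorem ExtIrreducible.eq_smul_one_of_commute [IsAlgClosed F] {G N : Subgroup (GL (Fin d) F)}
    (hNG : NormalIn N G) {k : ℕ} (h : ExtIrreducible G k) (hk : 2 ≤ k) (hkd : k + 2 ≤ d)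
    {a b : GL (Fin d) F} (ha : a ∈ N) (hb : b ∈ N) (hab : a * b ≠ b * a)
    (c : Matrix (Fin d) (Fin d) F)
    (hc : ∀ n ∈ N, c * (n : Matrix (Fin d) (Fin d) F) = n * c) :
    ∃ t : F, c = t • (1 : Matrix (Fin d) (Fin d) F) := by
  have : Nonempty (Fin d) := ⟨⟨0, by lia⟩⟩
  have hΓ : ∀ u ∈ G.map glEquiv.toMonoidHom, ∀ r ∈ envelope N,
      u.symm.toLinearMap ∘ₗ r ∘ₗ u.toLinearMap ∈ envelope N := by
    rintro _ ⟨g, hg, rfl⟩ r hr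
    exact conj_mem_envelope hNG hg hr
  obtain ⟨hss, e, he⟩ := isSemisimpleModule_of_normalized (envelope N)
    (G.map glEquiv.toMonoidHom) hΓ fun U hU =>
      h.eq_bot_or_eq_top (by lia) (by lia) U fun g hg => hU _ ⟨g, hg, rfl⟩
  have hed : d ≤ e := by
    by_contra! hed
    refine not_extIrreducible_of_homogeneous (R := envelope N) (fun g hg => ?_) he ?_ hed hk hkd h
    · refine ⟨twistIso (envelope N) (glEquiv g) (fun r hr => conj_mem_envelope hNG hg hr)
        (fun r hr => ?_), fun U => rfl⟩
      have := conj_mem_envelope hNG (G.inv_mem hg) hr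
      rw [coe_glEquiv, coe_glEquiv_symm, inv_inv] at this
      exact this
    · by_contra! h2
      have hcomm := fun x : Fin d → F => commute_apply_of_finrank_simple_le_one
        (fun U hU => (he U hU).trans_le (Nat.le_of_lt_succ h2))
        (mulVecLin_mem_envelope ha) (mulVecLin_mem_envelope hb) x
      refine hab (Units.ext (Matrix.toLin'.injective (LinearMap.ext fun x => ?_)))
      rw [Units.val_mul, Units.val_mul, Matrix.toLin'_mul, Matrix.toLin'_mul]
      exact hcomm x
  obtain ⟨W, hW⟩ := exists_isSimpleModule (envelope N) (F := F) (V := Fin d → F)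
  have hcR : ∀ r ∈ envelope N, c.mulVecLin * r = r * c.mulVecLin := fun r hr => by
    have hr' : r ∈ Subalgebra.centralizer F {c.mulVecLin} := by
      refine Algebra.adjoin_le ?_ hr
      rintro _ ⟨n, hn, rfl⟩
      rw [SetLike.mem_coe, Subalgebra.mem_centralizer_iff]
      rintro _ rfl
      rw [End.mul_eq_comp, End.mul_eq_comp, ← Matrix.mulVecLin_mul, hc n hn,
        Matrix.mulVecLin_mul]
    exact Subalgebra.mem_centralizer_iff F |>.mp hr' _ rfl
  obtain ⟨t, ht⟩ := eq_smul_one_of_simple_finrank_ge hW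
    (by rw [finrank_fin_fun]; exact hed.trans (he W hW).ge) hcR
  refine ⟨t, Matrix.toLin'.injective ?_⟩
  rw [map_smul, Matrix.toLin'_one, Matrix.toLin'_apply', ht]
  rfl

end Clifford

section Hyperbolic

variable {V : Type*} [AddCommGroup V] [Module F V]

/-- The vectors `e i`, `f i` span hyperbolic planes which are pairwise orthogonal for `B`. -/
structure IsHyperbolic (B : LinearMap.BilinForm F V) {n : ℕ} (e f : Fin n → V) : Prop where
  left : ∀ i j, B (e i) (e j) = 0
  right : ∀ i j, B (f i) (f j) = 0
  pair : ∀ i j, B (e i) (f j) = if i = j then 1 else 0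

variable {B : LinearMap.BilinForm F V} {n : ℕ} {e f : Fin n → V}

theorem IsHyperbolic.linearIndependent (h : IsHyperbolic B e f) :
    LinearIndependent F fun p : Fin n × Fin 2 => ![e p.1, f p.1] p.2 := by
  rw [Fintype.linearIndependent_iff]
  intro c hc
  simp only [Fintype.sum_prod_type, Fin.sum_univ_two, Matrix.cons_val_zero,
    Matrix.cons_val_one] at hc
  rintro ⟨i, t⟩
  fin_cases t
  · have := congrArg (fun v => B v (f i)) hc
    simpa [h.pair, h.right, Finset.sum_add_distrib] using this
  · have := congrArg (fun v => B (e i) v) hc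
    simpa [h.pair, h.left, Finset.sum_add_distrib] using this

theorem IsHyperbolic.card_le [Module.Finite F V] (h : IsHyperbolic B e f) :
    n * 2 ≤ Module.finrank F V := by
  simpa using (h.linearIndependent).fintype_card_le_finrank

theorem IsHyperbolic.exists_succ (hB : B.IsAlt) (hnd : ∀ x, x ≠ 0 → ∃ y, B x y ≠ 0)
    (h : IsHyperbolic B e f) {v : V} (hv : v ≠ ∑ i, (B v (f i) • e i - B v (e i) • f i)) :
    ∃ e' f' : Fin (n + 1) → V, IsHyperbolic B e' f' := by
  have skew : ∀ x y, B x y = -B y x := fun x y => (hB.neg_eq y x).symm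
  let p : V → V := fun v => v - ∑ i, (B v (f i) • e i - B v (e i) • f i)
  have hpe : ∀ v j, B (p v) (e j) = 0 := fun v j => by
    simp [p, h.left, skew (f _) (e j), h.pair]
  have hpf : ∀ v j, B (p v) (f j) = 0 := fun v j => by
    simp [p, h.right, h.pair]
  obtain ⟨y, hy⟩ := hnd (p v) (sub_ne_zero.mpr hv)
  have hpy : B (p v) (p y) = B (p v) y := by
    conv_lhs => enter [2]; simp only [p]
    simp [hpe, hpf]
  refine ⟨Fin.cons (p v) e, Fin.cons ((B (p v) y)⁻¹ • p y) f, ?_, ?_, ?_⟩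
  · intro i j
    refine Fin.cases ?_ (fun i => ?_) i <;> refine Fin.cases ?_ (fun j => ?_) j
    · exact hB _
    · simp [hpe]
    · simp [skew (e _) (p v), hpe]
    · simp [h.left]
  · intro i j
    refine Fin.cases ?_ (fun i => ?_) i <;> refine Fin.cases ?_ (fun j => ?_) j
    · exact hB _
    · simp [hpf]
    · simp [skew (f _) (p y), hpf]
    · simp [h.right]
  · intro i j
    refine Fin.cases ?_ (fun i => ?_) i <;> refine Fin.cases ?_ (fun j => ?_) j
    · simp [hpy, hy]
    · simp [hpf, (Fin.succ_ne_zero _).symm]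
    · simp [skew (e _) (p y), hpe, Fin.succ_ne_zero]
    · simp [h.pair]

theorem exists_isHyperbolic [Module.Finite F V] (hB : B.IsAlt)
    (hnd : ∀ x, x ≠ 0 → ∃ y, B x y ≠ 0) :
    ∃ (n : ℕ) (e f : Fin n → V), IsHyperbolic B e f ∧
      ∀ v, v = ∑ i, (B v (f i) • e i - B v (e i) • f i) := by
  by_contra! hcon
  have key : ∀ n : ℕ, ∃ e f : Fin n → V, IsHyperbolic B e f := fun n => by
    induction n with
    | zero => exact ⟨Fin.elim0, Fin.elim0, fun i => i.elim0, fun i => i.elim0, fun i => i.elim0⟩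
    | succ n ih =>
      obtain ⟨e, f, h⟩ := ih
      obtain ⟨v, hv⟩ := hcon n e f h
      exact h.exists_succ hB hnd hv
  obtain ⟨e, f, h⟩ := key (Module.finrank F V + 1)
  have := h.card_le
  lia

theorem IsAltMat.isAlt {J : Matrix (Fin d) (Fin d) F} (hJ : IsAltMat J) :
    (Matrix.toBilin' J).IsAlt := fun v => by
  rw [Matrix.toBilin'_apply, ← Fintype.sum_prod_type' fun a b => v a * J a b * v b]
  refine Finset.sum_involution (fun p _ => p.swap) ?_ ?_ (fun _ _ => Finset.mem_univ _)
    (fun _ _ => Prod.swap_swap _)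
  · rintro ⟨a, b⟩ -
    have : J b a = -J a b := congrFun (congrFun hJ.2.1 a) b
    simp only [Prod.swap, this]
    ring
  · rintro ⟨a, b⟩ - hne heq
    obtain rfl : b = a := congrArg Prod.fst heq
    simp [hJ.2.2] at hne

theorem IsAltMat.exists_ne_zero {J : Matrix (Fin d) (Fin d) F} (hJ : IsAltMat J)
    (x : Fin d → F) (hx : x ≠ 0) : ∃ y, Matrix.toBilin' J x y ≠ 0 := by
  by_contra! h
  refine hx (dotProduct_eq_zero x fun w => ?_)
  have := h (J⁻¹ *ᵥ w)
  rwa [Matrix.toBilin'_apply', Matrix.mulVec_mulVec,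
    Matrix.mul_nonsing_inv _ ((Matrix.isUnit_iff_isUnit_det J).mp hJ.1), Matrix.one_mulVec] at this

end Hyperbolic

section GeneratingFunction

open Polynomial

variable {Z ι : Type*} [CommRing Z] {s : ι → Z}

theorem prod_one_add_X_mul_C_coeff_card (S : Finset ι) :
    (∏ i ∈ S, (1 + X * C (s i))).coeff S.card = ∏ i ∈ S, s i := by
  have h := coeff_prod_of_natDegree_le (s := S) (fun i => 1 + X * C (s i)) 1 fun i _ => by
    compute_degree
  rw [mul_one] at h
  rw [h]
  exact Finset.prod_congr rfl fun i _ => by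
    rw [coeff_add, coeff_X_mul, coeff_C_zero, coeff_one, if_neg one_ne_zero, zero_add]

variable [DecidableEq ι]

theorem prod_one_add_X_mul_C_coeff_mul_prod (hs : ∀ i, s i * s i = 0) {S U : Finset ι}
    (hSU : S ⊆ U) :
    (∏ i ∈ U, (1 + X * C (s i))).coeff S.card * ∏ i ∈ U \ S, s i = ∏ i ∈ U, s i := by
  have h : ∀ i, (1 + X * C (s i)) * C (s i) = C (s i) := fun i => by
    rw [add_mul, one_mul, mul_assoc, ← C_mul, hs, C_0, mul_zero, add_zero]
  rw [← coeff_mul_C, map_prod, ← Finset.prod_sdiff hSU, mul_right_comm, ← Finset.prod_mul_distrib,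
    Finset.prod_congr rfl fun i _ => h i, ← map_prod, coeff_C_mul, prod_one_add_X_mul_C_coeff_card,
    Finset.prod_sdiff hSU]

theorem prod_one_add_X_mul_C_insert_coeff_mul_prod (hs : ∀ i, s i * s i = 0) {S U : Finset ι}
    (hSU : S ⊆ U) {a : ι} (ha : a ∉ U) :
    ∃ r, (∏ i ∈ insert a U, (1 + X * C (s i))).coeff S.card * ∏ i ∈ U \ S, s i =
      ∏ i ∈ U, s i + s a * r := by
  refine ⟨(X * ∏ i ∈ U, (1 + X * C (s i))).coeff S.card * ∏ i ∈ U \ S, s i, ?_⟩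
  rw [Finset.prod_insert ha, add_mul, one_mul, coeff_add, add_mul,
    prod_one_add_X_mul_C_coeff_mul_prod hs hSU, mul_comm X (C (s a)), mul_assoc (C (s a)),
    coeff_C_mul, mul_assoc]

end GeneratingFunction

section DividedPower

open Polynomial ExteriorAlgebra

variable {V : Type*} [AddCommGroup V] [Module F V]

theorem ι_mul_ι_comm (x y : V) : ι F x * ι F y = -(ι F y * ι F x) :=
  eq_neg_of_add_eq_zero_left (ι_add_mul_swap x y)

/-- The decomposable bivectors, as central elements of the exterior algebra. -/
def bivector (x y : V) : Subalgebra.center F (ExteriorAlgebra F V) :=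
  ⟨ι F x * ι F y, Subalgebra.mem_center_iff.mpr fun b => by
    induction b using ExteriorAlgebra.induction with
    | algebraMap r => exact Algebra.commutes _ _
    | ι z =>
      rw [← mul_assoc, ι_mul_ι_comm z x, mul_assoc, neg_mul, mul_assoc, ι_mul_ι_comm z y, mul_neg,
        neg_neg]
    | mul a b ha hb => rw [mul_assoc, hb, ← mul_assoc, ha, mul_assoc]
    | add a b ha hb => rw [add_mul, mul_add, ha, hb]⟩

theorem coe_bivector (x y : V) :
    ((bivector x y : Subalgebra.center F (ExteriorAlgebra F V)) : ExteriorAlgebra F V) =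
      ι F x * ι F y := rfl

theorem bivector_add_left (x x' y : V) :
    bivector (F := F) (x + x') y = bivector x y + bivector x' y :=
  Subtype.ext (by simp [coe_bivector, add_mul])

theorem bivector_add_right (x y y' : V) :
    bivector (F := F) x (y + y') = bivector x y + bivector x y' :=
  Subtype.ext (by simp [coe_bivector, mul_add])

theorem bivector_smul_left (c : F) (x y : V) : 
    bivector (c • x) y = c • bivector (F := F) x y :=
  Subtype.ext (by simp [coe_bivector])

theorem bivector_smul_right (c : F) (x y : V) : 
    bivector x (c • y) = c • bivector (F := F) x y :=
  Subtype.ext (by simp [coe_bivector])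

theorem bivector_self (x : V) : bivector (F := F) x x = 0 :=
  Subtype.ext (ι_sq_zero x)

theorem bivector_add_swap (x y : V) : bivector (F := F) x y + bivector y x = 0 :=
  Subtype.ext (ι_add_mul_swap x y)

theorem bivector_mul_bivector_middle (x y z : V) : bivector (F := F) x y * bivector y z = 0 :=
  Subtype.ext <| by
    rw [MulMemClass.coe_mul, coe_bivector, coe_bivector, mul_assoc, ← mul_assoc (ι F y),
      ι_sq_zero, zero_mul, mul_zero]
    rfl

theorem bivector_mul_bivector_right (x x' y : V) : bivector (F := F) x y * bivector x' y = 0 :=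
  Subtype.ext <| by
    rw [MulMemClass.coe_mul, coe_bivector, coe_bivector, ι_mul_ι_comm x' y, mul_neg, mul_assoc,
      ← mul_assoc (ι F y), ι_sq_zero, zero_mul, mul_zero, neg_zero]
    rfl

theorem bivector_mul_bivector_left (x y y' : V) : bivector (F := F) x y * bivector x y' = 0 :=
  Subtype.ext <| by
    rw [MulMemClass.coe_mul, coe_bivector, coe_bivector, ι_mul_ι_comm x y, neg_mul, mul_assoc,
      ← mul_assoc (ι F x), ι_sq_zero, zero_mul, mul_zero, neg_zero]
    rfl

/-- The polynomial `1 + X (x ∧ y)`, which is biadditive in `x`, `y` with multiplicative values. -/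
def expPoly (x y : V) : (Subalgebra.center F (ExteriorAlgebra F V))[X] :=
  1 + X * C (bivector x y)

theorem one_add_X_mul_C_mul {Z : Type*} [CommRing Z] {s t : Z} (h : s * t = 0) :
    (1 + X * C s) * (1 + X * C t) = 1 + X * C (s + t) := by
  have h' : C s * C t = 0 := by rw [← C_mul, h, C_0]
  rw [C_add]
  linear_combination X ^ 2 * h'

theorem expPoly_add_left (x x' y : V) :
    expPoly (F := F) (x + x') y = expPoly x y * expPoly x' y := by
  rw [expPoly, expPoly, expPoly, one_add_X_mul_C_mul (bivector_mul_bivector_right x x' y),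
    bivector_add_left]

theorem expPoly_add_right (x y y' : V) :
    expPoly (F := F) x (y + y') = expPoly x y * expPoly x y' := by
  rw [expPoly, expPoly, expPoly, one_add_X_mul_C_mul (bivector_mul_bivector_left x y y'),
    bivector_add_right]

theorem expPoly_eq_one {x y : V} (h : bivector (F := F) x y = 0) : expPoly (F := F) x y = 1 := by
  rw [expPoly, h, C_0, mul_zero, add_zero]

theorem expPoly_sum_left {κ : Type*} (S : Finset κ) (x : κ → V) (y : V) :
    expPoly (F := F) (∑ i ∈ S, x i) y = ∏ i ∈ S, expPoly (x i) y := by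
  classical
  induction S using Finset.induction with
  | empty => exact expPoly_eq_one (Subtype.ext (by simp [coe_bivector]))
  | insert a S ha ih => rw [Finset.sum_insert ha, Finset.prod_insert ha, expPoly_add_left, ih]

theorem expPoly_sum_right {κ : Type*} (S : Finset κ) (x : V) (y : κ → V) :
    expPoly (F := F) x (∑ i ∈ S, y i) = ∏ i ∈ S, expPoly x (y i) := by
  classical
  induction S using Finset.induction with
  | empty => exact expPoly_eq_one (Subtype.ext (by simp [coe_bivector]))
  | insert a S ha ih => rw [Finset.sum_insert ha, Finset.prod_insert ha, expPoly_add_right, ih]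

/-- The exponential generating polynomial of the bivector with coefficient matrix `T`. -/
def expMatrix (T : Matrix (Fin d) (Fin d) F) :
    (Subalgebra.center F (ExteriorAlgebra F (Fin d → F)))[X] :=
  ∏ p : Fin d × Fin d, expPoly (T p.1 p.2 • Pi.single p.1 (1 : F)) (Pi.single p.2 (1 : F))

theorem expMatrix_zero : expMatrix (0 : Matrix (Fin d) (Fin d) F) = 1 :=
  Finset.prod_eq_one fun p _ => expPoly_eq_one (Subtype.ext (by simp [coe_bivector]))

theorem expMatrix_add (T T' : Matrix (Fin d) (Fin d) F) :
    expMatrix (T + T') = expMatrix T * expMatrix T' := by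
  simp only [expMatrix, Matrix.add_apply, add_smul, expPoly_add_left, Finset.prod_mul_distrib]

theorem expMatrix_sum {κ : Type*} (S : Finset κ) (T : κ → Matrix (Fin d) (Fin d) F) :
    expMatrix (∑ i ∈ S, T i) = ∏ i ∈ S, expMatrix (T i) := by
  classical
  induction S using Finset.induction with
  | empty => exact expMatrix_zero
  | insert a S ha ih => rw [Finset.sum_insert ha, Finset.prod_insert ha, expMatrix_add, ih]

theorem expMatrix_vecMulVec (x y : Fin d → F) : expMatrix (vecMulVec x y) = expPoly x y := by
  have hx : ∀ x : Fin d → F, x = ∑ i, x i • Pi.single i (1 : F) := fun x => by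
    simpa using pi_eq_sum_univ' x
  conv_rhs => rw [hx x, hx y, expPoly_sum_left]
  rw [expMatrix, Fintype.prod_prod_type]
  refine Finset.prod_congr rfl fun i _ => ?_
  rw [expPoly_sum_right]
  refine Finset.prod_congr rfl fun j _ => ?_
  simp only [expPoly, bivector_smul_left, bivector_smul_right, vecMulVec_apply, smul_smul,
    mul_comm]

theorem expMatrix_eq_one {T : Matrix (Fin d) (Fin d) F} (hT : Tᵀ = T) : expMatrix T = 1 := by
  refine Finset.prod_involution (fun p _ => p.swap) ?_ ?_ (fun _ _ => Finset.mem_univ _)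
    (fun _ _ => Prod.swap_swap _)
  · rintro ⟨a, b⟩ -
    have h : T b a = T a b := congrFun (congrFun hT a) b
    simp only [Prod.swap, h, expPoly]
    rw [one_add_X_mul_C_mul, bivector_smul_left, bivector_smul_left, ← smul_add,
      bivector_add_swap, smul_zero, C_0, mul_zero, add_zero]
    rw [bivector_smul_left (T a b) (Pi.single b 1), ← bivector_smul_right,
      bivector_mul_bivector_middle]
  · rintro ⟨a, b⟩ - hne heq
    obtain rfl : b = a := congrArg Prod.fst heq
    exact hne (expPoly_eq_one (by rw [bivector_smul_left, bivector_self, smul_zero]))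

theorem expMatrix_congr {T T' : Matrix (Fin d) (Fin d) F} (h : T - Tᵀ = T' - T'ᵀ) :
    expMatrix T = expMatrix T' := by
  have hsymm : (T - T')ᵀ = T - T' := by
    rw [transpose_sub, ← sub_eq_zero]
    rw [← sub_eq_zero] at h
    rw [← neg_eq_zero, ← h]
    abel
  rw [← sub_add_cancel T T', expMatrix_add, expMatrix_eq_one hsymm, one_mul]

/-- The divided power of the bivector `∑ e i ∧ f i`. -/
def dividedPower {n : ℕ} (e f : Fin n → V) (j : ℕ) : Subalgebra.center F (ExteriorAlgebra F V) :=
  (∏ i, expPoly (e i) (f i)).coeff j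

theorem dividedPower_congr {n : ℕ} {e f e' f' : Fin n → Fin d → F}
    (h : ∑ i, vecMulVec (e i) (f i) - (∑ i, vecMulVec (e i) (f i))ᵀ =
      ∑ i, vecMulVec (e' i) (f' i) - (∑ i, vecMulVec (e' i) (f' i))ᵀ) (j : ℕ) :
    dividedPower (F := F) e f j = dividedPower e' f' j := by
  simp only [dividedPower, ← expMatrix_vecMulVec, ← expMatrix_sum]
  rw [expMatrix_congr h]

theorem dividedPower_smul {n : ℕ} (e f : Fin n → V) (c : F) (j : ℕ) :
    dividedPower (c • e) f j = c ^ j • dividedPower (F := F) e f j := by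
  have h : ∀ i, expPoly ((c • e) i) (f i) = (expPoly (e i) (f i)).comp
      (C (algebraMap F (Subalgebra.center F (ExteriorAlgebra F V)) c) * X) := fun i => by
    simp only [expPoly, Pi.smul_apply, bivector_smul_left, add_comp, one_comp, X_mul_C, mul_comp,
      C_comp, X_comp, Algebra.smul_def, C_mul]
    ring
  rw [dividedPower, Finset.prod_congr rfl fun i _ => h i, ← Polynomial.prod_comp,
    comp_C_mul_X_coeff, Algebra.smul_def, map_pow, mul_comm]
  rfl

/-- Surjective algebra endomorphisms preserve the center. -/
def centerMap {A : Type*} [Ring A] [Algebra F A] (φ : A →ₐ[F] A) (hφ : Function.Surjective φ) :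
    Subalgebra.center F A →ₐ[F] Subalgebra.center F A :=
  (φ.comp (Subalgebra.center F A).val).codRestrict _ fun x => Subalgebra.mem_center_iff.mpr <|
    hφ.forall.mpr fun b => by
      have := Subalgebra.mem_center_iff.mp x.2 b
      simp only [AlgHom.comp_apply, Subalgebra.coe_val]
      rw [← map_mul, this, map_mul]

theorem map_dividedPower {n : ℕ} (e f : Fin n → V) (j : ℕ) {u : V →ₗ[F] V}
    (hu : Function.Surjective u) :
    ExteriorAlgebra.map u (dividedPower (F := F) e f j) =
      dividedPower (F := F) (u ∘ e) (u ∘ f) j := by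
  let ρ := centerMap (ExteriorAlgebra.map u) (ExteriorAlgebra.map_surjective_iff.mpr hu)
  change ((ρ (dividedPower e f j) : Subalgebra.center F (ExteriorAlgebra F V)) :
    ExteriorAlgebra F V) = _
  have h : ∀ i, (expPoly (e i) (f i)).map ρ.toRingHom = expPoly (u (e i)) (u (f i)) := fun i => by
    have hb : ρ (bivector (e i) (f i)) = bivector (u (e i)) (u (f i)) :=
      Subtype.ext <| by
        change ExteriorAlgebra.map u (ι F (e i) * ι F (f i)) = ι F (u (e i)) * ι F (u (f i))
        rw [map_mul, map_apply_ι, map_apply_ι]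
    rw [expPoly, expPoly, ← hb]
    simp
  rw [dividedPower, dividedPower]
  congr 1
  simp only [Function.comp_apply, ← h, ← Polynomial.map_prod, Polynomial.coeff_map]
  rfl

theorem prod_expPoly_coeff_mem {κ : Type*} (S : Finset κ) (e f : κ → V) (j : ℕ) :
    (((∏ i ∈ S, expPoly (F := F) (e i) (f i)).coeff j :
      Subalgebra.center F (ExteriorAlgebra F V)) : ExteriorAlgebra F V) ∈ ⋀[F]^(2 * j) V := by
  classical
  induction S using Finset.induction generalizing j with
  | empty =>
    rcases j with - | j
    · simp [Submodule.one_le.mp]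
    · simp [coeff_one]
  | insert a S ha ih =>
    rw [Finset.prod_insert ha, expPoly, add_mul, one_mul, mul_assoc, coeff_add]
    refine add_mem (ih j) ?_
    rcases j with - | j
    · simp
    · rw [coeff_X_mul, coeff_C_mul, mul_add, add_comm, exteriorPower, pow_add]
      refine Submodule.mul_mem_mul ?_ (ih j)
      rw [mul_one, pow_two]
      exact Submodule.mul_mem_mul ⟨_, rfl⟩ ⟨_, rfl⟩

theorem dividedPower_mem {n : ℕ} (e f : Fin n → V) (j : ℕ) :
    (dividedPower (F := F) e f j : ExteriorAlgebra F V) ∈ ⋀[F]^(2 * j) V :=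
  prod_expPoly_coeff_mem _ e f j

end DividedPower

section Nonvanishing

open ExteriorAlgebra

variable {V : Type*} [AddCommGroup V] [Module F V] {B : LinearMap.BilinForm F V} {n : ℕ}
  {e f : Fin n → V}

theorem coe_prod_bivector (e f : Fin n → V) :
    ((∏ i, bivector (e i) (f i) : Subalgebra.center F (ExteriorAlgebra F V)) :
      ExteriorAlgebra F V) =
    ιMulti F (n * 2) fun p => ![e (finProdFinEquiv.symm p).1, f (finProdFinEquiv.symm p).1]
      (finProdFinEquiv.symm p).2 := by
  rw [ιMulti_apply, List.ofFn_mul, List.prod_flatten, List.map_ofFn, ← List.prod_ofFn,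
    ← Subalgebra.coe_val, map_list_prod, List.map_ofFn]
  congr 2
  funext i
  have h : ∀ t : Fin 2, ∀ H : (i : ℕ) * 2 + t < n * 2,
      finProdFinEquiv.symm (⟨(i : ℕ) * 2 + t, H⟩ : Fin (n * 2)) = (i, t) := fun t H => by
    rw [Equiv.symm_apply_eq]
    ext
    simp [finProdFinEquiv, mul_comm, add_comm]
  simp only [Function.comp_apply, h]
  simp [coe_bivector]

theorem IsHyperbolic.prod_bivector_ne_zero (h : IsHyperbolic B e f) :
    (∏ i, bivector (e i) (f i) : Subalgebra.center F (ExteriorAlgebra F V)) ≠ 0 := fun h0 => by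
  refine ιMulti_ne_zero (h.linearIndependent.comp _ finProdFinEquiv.symm.injective) ?_
  exact (coe_prod_bivector e f).symm.trans (congrArg Subtype.val h0)

theorem bivector_mul_self (x y : V) : bivector (F := F) x y * bivector x y = 0 :=
  bivector_mul_bivector_left x y y

theorem IsHyperbolic.dividedPower_ne_zero (h : IsHyperbolic B e f) {j : ℕ} (hj : j ≤ n) :
    dividedPower (F := F) e f j ≠ 0 := fun h0 => by
  obtain ⟨S, -, rfl⟩ := Finset.exists_subset_card_eq
    (s := (Finset.univ : Finset (Fin n))) (n := j) (by simpa using hj)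
  have := prod_one_add_X_mul_C_coeff_mul_prod
    (fun i => bivector_mul_self (F := F) (e i) (f i)) S.subset_univ
  refine h.prod_bivector_ne_zero (this.symm.trans ?_)
  rw [dividedPower] at h0
  simp only [expPoly] at h0
  rw [h0, zero_mul]

theorem IsHyperbolic.ι_mul_dividedPower_ne_zero (h : IsHyperbolic B e f)
    (hexp : ∀ v, v = ∑ i, (B v (f i) • e i - B v (e i) • f i)) {j : ℕ} (hj : j < n) {v : V}
    (hv : v ≠ 0) : ι F v * (dividedPower (F := F) e f j : ExteriorAlgebra F V) ≠ 0 := by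
  intro h0
  let w : Fin n → V := fun i => B v (f i) • e i - B v (e i) • f i
  have key : ∀ (i : Fin n) (x : V), (∀ y, bivector (F := F) x y * bivector (e i) (f i) = 0) →
      bivector (F := F) x (w i) * ∏ l ∈ Finset.univ.erase i, bivector (e l) (f l) = 0 := by
    intro i x hx
    have hx0 : bivector (F := F) x v * dividedPower e f j = 0 := Subtype.ext <| by
      rw [MulMemClass.coe_mul, coe_bivector, mul_assoc, h0, mul_zero]
      rfl
    obtain ⟨S, hS, rfl⟩ := Finset.exists_subset_card_eq
      (s := (Finset.univ : Finset (Fin n)).erase i) (n := j) (by simp; lia)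
    obtain ⟨r, hr⟩ := prod_one_add_X_mul_C_insert_coeff_mul_prod
      (fun i => bivector_mul_self (F := F) (e i) (f i)) hS (Finset.notMem_erase i _)
    rw [Finset.insert_erase (Finset.mem_univ i)] at hr
    have hv0 : bivector (F := F) x v * ∏ l ∈ Finset.univ.erase i, bivector (e l) (f l) = 0 := by
      have := congrArg (bivector (F := F) x v * ·) hr
      simp only [mul_add] at this
      rw [← mul_assoc, ← mul_assoc _ _ r, hx, zero_mul, add_zero] at this
      rw [← this]
      exact (congrArg (· * _) hx0).trans (zero_mul _)
    have hw0 : bivector (F := F) x (∑ l ∈ Finset.univ.erase i, w l) *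
        ∏ l ∈ Finset.univ.erase i, bivector (e l) (f l) = 0 := by
      refine Finset.sum_induction _ (fun z => bivector (F := F) x z *
        ∏ l ∈ Finset.univ.erase i, bivector (e l) (f l) = 0) (fun y z hy hz => ?_) ?_
        fun l hl => ?_
      · rw [bivector_add_right, add_mul, hy, hz, add_zero]
      · rw [← zero_smul F (0 : V), bivector_smul_right, zero_smul, zero_mul]
      · rw [← Finset.mul_prod_erase _ _ hl, ← mul_assoc]
        have : bivector (F := F) x (w l) * bivector (e l) (f l) = 0 := by
          rw [show w l = B v (f l) • e l + (-B v (e l)) • f l by simp [w, sub_eq_add_neg],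
            bivector_add_right, bivector_smul_right, bivector_smul_right, add_mul, smul_mul_assoc,
            smul_mul_assoc, bivector_mul_bivector_middle, bivector_mul_bivector_right, smul_zero,
            smul_zero, add_zero]
        rw [this, zero_mul]
    rw [hexp v, ← Finset.add_sum_erase _ _ (Finset.mem_univ i), bivector_add_right, add_mul] at hv0
    exact (add_zero _).symm.trans ((congrArg (_ + ·) hw0.symm).trans hv0)
  have hcoef : ∀ (i : Fin n) (x : V) (c : F),
      (∀ y, bivector (F := F) x y * bivector (e i) (f i) = 0) →
      ι F x * ι F (w i) = c • (ι F (e i) * ι F (f i)) → c = 0 := by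
    intro i x c hx hc
    have hb : bivector (F := F) x (w i) = c • bivector (e i) (f i) := Subtype.ext hc
    have := key i x hx
    rw [hb, smul_mul_assoc, Finset.mul_prod_erase Finset.univ (fun l => bivector (e l) (f l))
      (Finset.mem_univ i)] at this
    exact (smul_eq_zero.mp this).resolve_right h.prod_bivector_ne_zero
  have hf : ∀ i, B v (f i) = 0 := fun i => neg_eq_zero.mp <| hcoef i (f i) _
    (fun y => by rw [mul_comm, bivector_mul_bivector_middle])
    (by simp [w, mul_sub, ι_mul_ι_comm (f i) (e i)])
  have he : ∀ i, B v (e i) = 0 := fun i => neg_eq_zero.mp <| hcoef i (e i) _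
    (fun y => bivector_mul_bivector_left _ _ _) (by simp [w, mul_sub])
  exact hv ((hexp v).trans (by simp [hf, he]))

end Nonvanishing

section Similitude

open ExteriorAlgebra

theorem finrank_le_of_expansion {V : Type*} [AddCommGroup V] [Module F V]
    {B : LinearMap.BilinForm F V} {n : ℕ} {e f : Fin n → V}
    (hexp : ∀ v, v = ∑ i, (B v (f i) • e i - B v (e i) • f i)) :
    Module.finrank F V ≤ 2 * n := by
  have htop : Submodule.span F (Set.range (Sum.elim e f)) = ⊤ := by
    refine (Submodule.eq_top_iff' (p := _)).mpr fun v => ?_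
    rw [hexp v]
    exact sum_mem fun i _ => sub_mem (Submodule.smul_mem _ _ (Submodule.subset_span ⟨.inl i, rfl⟩))
      (Submodule.smul_mem _ _ (Submodule.subset_span ⟨.inr i, rfl⟩))
  have := finrank_range_le_card (R := F) (Sum.elim e f)
  rw [Set.finrank, htop, finrank_top] at this
  simpa [two_mul] using this

theorem IsAltMat.mul_eq_one_of_expansion {J : Matrix (Fin d) (Fin d) F} (hJ : IsAltMat J) {n : ℕ}
    {e f : Fin n → Fin d → F}
    (hexp : ∀ v, v = ∑ i, (toBilin' J v (f i) • e i - toBilin' J v (e i) • f i)) :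
    ((∑ i, vecMulVec (e i) (f i))ᵀ - ∑ i, vecMulVec (e i) (f i)) * J = 1 := by
  refine ext_of_mulVec_single fun i => ?_
  generalize (Pi.single i 1 : Fin d → F) = v
  have h : ∀ x, toBilin' J v x = -(x ⬝ᵥ J *ᵥ v) := fun x => by
    rw [← hJ.isAlt.neg_eq, toBilin'_apply']
  rw [one_mulVec, ← mulVec_mulVec, sub_mulVec, transpose_sum, sum_mulVec, sum_mulVec,
    ← Finset.sum_sub_distrib]
  conv_rhs => rw [hexp v]
  refine Finset.sum_congr rfl fun i _ => ?_
  rw [transpose_vecMulVec, vecMulVec_mulVec, vecMulVec_mulVec, h, h, op_smul_eq_smul,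
    op_smul_eq_smul, neg_smul, neg_smul, sub_neg_eq_add, neg_add_eq_sub]

theorem IsAltMat.similitude_mul_mul_transpose {J : Matrix (Fin d) (Fin d) F} (hJ : IsAltMat J)
    {L A : Matrix (Fin d) (Fin d) F} (hL : L * J = 1) (hA : IsUnit A) {c : F}
    (hc : Aᵀ * J * A = c • J) : A * L * Aᵀ = c • L := by
  refine hJ.1.mul_left_injective (hA.mul_left_injective ?_)
  dsimp only
  rw [smul_mul_assoc, hL, smul_mul_assoc, one_mul, Matrix.mul_assoc _ J, Matrix.mul_assoc _ _ᵀ,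
    ← Matrix.mul_assoc _ᵀ, hc, Matrix.mul_assoc, Matrix.mul_smul, hL, Matrix.mul_smul,
    Matrix.mul_one]

theorem extSubst_dividedPower {J : Matrix (Fin d) (Fin d) F} (hJ : IsAltMat J) {n : ℕ}
    {e f : Fin n → Fin d → F}
    (hexp : ∀ v, v = ∑ i, (toBilin' J v (f i) • e i - toBilin' J v (e i) • f i))
    {A : Matrix (Fin d) (Fin d) F} (hA : IsUnit A) {c : F} (hc : Aᵀ * J * A = c • J) (j : ℕ) :
    extSubst A (dividedPower e f j : Subalgebra.center F (ExteriorAlgebra F (Fin d → F))) =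
      c ^ j • ((dividedPower e f j : Subalgebra.center F (ExteriorAlgebra F (Fin d → F))) :
        ExteriorAlgebra F (Fin d → F)) := by
  have h : dividedPower (F := F) (A.mulVecLin ∘ e) (A.mulVecLin ∘ f) j =
      dividedPower (c • e) f j := by
    refine dividedPower_congr ?_ j
    have h1 : ∑ i, vecMulVec ((A.mulVecLin ∘ e) i) ((A.mulVecLin ∘ f) i) =
        A * (∑ i, vecMulVec (e i) (f i)) * Aᵀ := by
      simp [Matrix.mul_sum, Matrix.sum_mul, mul_vecMulVec, vecMulVec_mul, vecMul_transpose]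
    have h2 : ∑ i, vecMulVec ((c • e) i) (f i) = c • ∑ i, vecMulVec (e i) (f i) := by
      simp [smul_vecMulVec, Finset.smul_sum]
    rw [h1, h2, ← neg_inj, neg_sub, neg_sub, transpose_smul, ← smul_sub,
      ← hJ.similitude_mul_mul_transpose (hJ.mul_eq_one_of_expansion hexp) hA hc, transpose_mul,
      transpose_mul, transpose_transpose, Matrix.mul_sub, Matrix.sub_mul, Matrix.mul_assoc _ _ᵀ]
  exact (map_dividedPower e f j (mulVec_surjective_iff_isUnit.mpr hA)).trans
    (congrArg Subtype.val (h.trans (dividedPower_smul e f c j)))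

/-- The divided powers of the bivector dual to a symplectic form, which are semi-invariant under
all similitudes of the form. -/
theorem IsAltMat.exists_dividedPower {J : Matrix (Fin d) (Fin d) F} (hJ : IsAltMat J) :
    ∃ (n : ℕ) (ω : ℕ → ExteriorAlgebra F (Fin d → F)), d ≤ 2 * n ∧
      (∀ j, ω j ∈ ⋀[F]^(2 * j) (Fin d → F)) ∧ (∀ j ≤ n, ω j ≠ 0) ∧
      (∀ j < n, ∀ v, v ≠ 0 → ι F v * ω j ≠ 0) ∧
      ∀ (g : GL (Fin d) F) (c : F),
        (g : Matrix (Fin d) (Fin d) F)ᵀ * J * (g : Matrix (Fin d) (Fin d) F) = c • J →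
        ∀ j, extSubst (g : Matrix (Fin d) (Fin d) F) (ω j) = c ^ j • ω j := by
  obtain ⟨n, e, f, h, hexp⟩ := exists_isHyperbolic hJ.isAlt hJ.exists_ne_zero
  refine ⟨n, fun j => (dividedPower e f j : Subalgebra.center F (ExteriorAlgebra F (Fin d → F))),
    by simpa using finrank_le_of_expansion hexp,
    dividedPower_mem e f, fun j hj h0 => h.dividedPower_ne_zero hj (Subtype.ext h0),
    fun j hj v hv => h.ι_mul_dividedPower_ne_zero hexp hj hv, fun g c hg j =>
      extSubst_dividedPower hJ hexp g.isUnit hg j⟩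

end Similitude

section SymplecticNormal

open ExteriorAlgebra

/-- Exterior multiplication of vectors with a fixed element. -/
def wedgeMap (x : ExteriorAlgebra F (Fin d → F)) :
    (Fin d → F) →ₗ[F] ExteriorAlgebra F (Fin d → F) :=
  LinearMap.mulRight F x ∘ₗ ι F

theorem wedgeMap_apply (x : ExteriorAlgebra F (Fin d → F)) (v : Fin d → F) :
    wedgeMap x v = ι F v * x := rfl

theorem wedgeMap_mem {x : ExteriorAlgebra F (Fin d → F)} {k : ℕ}
    (hx : x ∈ ⋀[F]^k (Fin d → F)) (v : Fin d → F) :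
    wedgeMap x v ∈ ⋀[F]^(k + 1) (Fin d → F) := by
  rw [exteriorPower, pow_succ']
  exact Submodule.mul_mem_mul (LinearMap.mem_range_self (ι F) v) hx

theorem extSubst_wedgeMap {A : Matrix (Fin d) (Fin d) F} {x : ExteriorAlgebra F (Fin d → F)} {c : F}
    (h : extSubst A x = c • x) (v : Fin d → F) :
    extSubst A (wedgeMap x v) = wedgeMap x (c • A *ᵥ v) := by
  rw [wedgeMap_apply, map_mul, h, wedgeMap_apply, extSubst, map_apply_ι, map_smul,
    mul_smul_comm, smul_mul_assoc, mulVecLin_apply]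

theorem transpose_mul_mul_eq_of_mem_SpGroup {J : Matrix (Fin d) (Fin d) F} {n : GL (Fin d) F}
    (hn : n ∈ SpGroup J) :
    (n : Matrix (Fin d) (Fin d) F)ᵀ * J * (n : Matrix (Fin d) (Fin d) F) = J := by
  have h : ((n : Matrix (Fin d) (Fin d) F).map (RingHom.id F))ᵀ * J *
    (n : Matrix (Fin d) (Fin d) F) = J := hn
  simpa using h

theorem lt_choose_of_two_le {d k : ℕ} (hk : 2 ≤ k) (hkd : k + 2 ≤ d) : d < d.choose k := by
  induction d generalizing k with
  | zero => lia
  | succ d ih =>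
    obtain ⟨k, rfl⟩ : ∃ m, k = m + 1 := ⟨k - 1, by lia⟩
    rw [Nat.choose_succ_succ]
    have h1 : d ≤ d.choose k := by
      rcases Nat.lt_or_ge k 2 with h | h
      · obtain rfl : k = 1 := by lia
        simp
      · exact (ih h (by lia)).le
    rcases Nat.lt_or_ge d (k + 3) with h | h
    · obtain rfl : d = k + 2 := by lia
      have : (k + 2).choose (k + 1) = k + 2 := Nat.choose_succ_self_right (k + 1)
      rcases Nat.lt_or_ge k 2 with h' | h'
      · obtain rfl : k = 1 := by lia
        decide
      · have := ih h' le_rfl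
        lia
    · have := ih hk h
      lia

theorem ExtIrreducible.finrank_le {G : Subgroup (GL (Fin d) F)} {k : ℕ} (h : ExtIrreducible G k)
    {W : Submodule F (ExteriorAlgebra F (Fin d → F))} (hW : W ≤ ⋀[F]^k (Fin d → F))
    (hG : ExtInvariant G W) (hne : W ≠ ⊥) : d.choose k = Module.finrank F W := by
  rw [(h.2 W hW hG).resolve_left hne, exteriorPower.finrank_eq, Module.finrank_fin_fun]

/-- A group normalizing a subgroup of the symplectic group with only scalar centralizer consists
of symplectic similitudes. -/
theorem exists_similitude {J : Matrix (Fin d) (Fin d) F} (hJ : IsAltMat J)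
    {G N : Subgroup (GL (Fin d) F)} (hNG : NormalIn N G) (hNSp : N ≤ SpGroup J)
    (hcent : ∀ c : Matrix (Fin d) (Fin d) F,
      (∀ n ∈ N, c * (n : Matrix (Fin d) (Fin d) F) = n * c) → ∃ t : F, c = t • 1)
    {g : GL (Fin d) F} (hg : g ∈ G) :
    ∃ t : F, (g : Matrix (Fin d) (Fin d) F)ᵀ * J * (g : Matrix (Fin d) (Fin d) F) = t • J := by
  obtain ⟨K, rfl⟩ := hJ.1
  set X : Matrix (Fin d) (Fin d) F := (g : Matrix (Fin d) (Fin d) F)ᵀ *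
    (K : Matrix (Fin d) (Fin d) F) * (g : Matrix (Fin d) (Fin d) F) with hX
  have hcomm : ∀ n ∈ N, (K⁻¹ : GL (Fin d) F) * X * (n : Matrix (Fin d) (Fin d) F) =
      n * ((K⁻¹ : GL (Fin d) F) * X) := by
    intro n hn
    have hn1 := transpose_mul_mul_eq_of_mem_SpGroup (hNSp hn)
    have hn2 := transpose_mul_mul_eq_of_mem_SpGroup (hNSp (hNG.2 g hg n hn))
    have hgn : ((g * n * g⁻¹ : GL (Fin d) F) : Matrix (Fin d) (Fin d) F) *
        (g : Matrix (Fin d) (Fin d) F) = g * n := by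
      rw [← Units.val_mul, inv_mul_cancel_right, Units.val_mul]
    have hXn : (n : Matrix (Fin d) (Fin d) F)ᵀ * X * (n : Matrix (Fin d) (Fin d) F) = X := by
      calc _ = ((g : Matrix (Fin d) (Fin d) F) * (n : Matrix (Fin d) (Fin d) F))ᵀ *
            (K : Matrix (Fin d) (Fin d) F) *
            ((g : Matrix (Fin d) (Fin d) F) * (n : Matrix (Fin d) (Fin d) F)) := by
            simp only [hX, transpose_mul, Matrix.mul_assoc]
        _ = (g : Matrix (Fin d) (Fin d) F)ᵀ * (((g * n * g⁻¹ : GL (Fin d) F) :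
              Matrix (Fin d) (Fin d) F)ᵀ * (K : Matrix (Fin d) (Fin d) F) *
              ((g * n * g⁻¹ : GL (Fin d) F) : Matrix (Fin d) (Fin d) F)) *
              (g : Matrix (Fin d) (Fin d) F) := by
            rw [← hgn]
            simp only [transpose_mul, Matrix.mul_assoc]
        _ = X := by rw [hn2]
    have hKn : (n : Matrix (Fin d) (Fin d) F) * (K⁻¹ : GL (Fin d) F) *
        (n : Matrix (Fin d) (Fin d) F)ᵀ = (K⁻¹ : GL (Fin d) F) := by
      have h1 : ((K⁻¹ : GL (Fin d) F) : Matrix (Fin d) (Fin d) F) *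
          (K : Matrix (Fin d) (Fin d) F) = 1 := by simp
      have := hJ.similitude_mul_mul_transpose h1 n.isUnit (c := 1) (by rw [hn1, one_smul])
      rwa [one_smul] at this
    calc (K⁻¹ : GL (Fin d) F) * X * (n : Matrix (Fin d) (Fin d) F)
        = n * (K⁻¹ : GL (Fin d) F) * ((n : Matrix (Fin d) (Fin d) F)ᵀ * X *
            (n : Matrix (Fin d) (Fin d) F)) := by
          nth_rewrite 1 [← hKn]
          simp only [Matrix.mul_assoc]
      _ = n * ((K⁻¹ : GL (Fin d) F) * X) := by rw [hXn, Matrix.mul_assoc]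
  obtain ⟨t, ht⟩ := hcent _ hcomm
  refine ⟨t, ?_⟩
  have := congrArg ((K : Matrix (Fin d) (Fin d) F) * ·) ht
  simpa [← Matrix.mul_assoc] using this

theorem not_extIrreducible_of_similitude {J : Matrix (Fin d) (Fin d) F} (hJ : IsAltMat J)
    {G : Subgroup (GL (Fin d) F)} (hG : ∀ g ∈ G, ∃ t : F,
      (g : Matrix (Fin d) (Fin d) F)ᵀ * J * (g : Matrix (Fin d) (Fin d) F) = t • J)
    {k : ℕ} (hk : 2 ≤ k) (hkd : k + 2 ≤ d) : ¬ ExtIrreducible G k := by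
  intro h
  obtain ⟨n, ω, hdn, hmem, hne, hinj, hinv⟩ := hJ.exists_dividedPower
  have hlt := lt_choose_of_two_le hk hkd
  obtain ⟨j, rfl | rfl⟩ := k.even_or_odd'
  · have := h.finrank_le (W := Submodule.span F {ω j})
      ((Submodule.span_singleton_le_iff_mem _ _).mpr (hmem j)) ?_
      (mt Submodule.span_singleton_eq_bot.mp (hne j (by lia)))
    · have := finrank_span_singleton (K := F) (hne j (by lia))
      lia
    · intro g hg v hv
      obtain ⟨t, ht⟩ := hG g hg
      obtain ⟨s, rfl⟩ := Submodule.mem_span_singleton.mp hv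
      rw [map_smul, hinv g t ht, smul_smul]
      exact Submodule.smul_mem _ _ (Submodule.mem_span_singleton_self _)
  · have := h.finrank_le (W := LinearMap.range (wedgeMap (ω j)))
      (LinearMap.range_le_iff_comap.mpr (Submodule.eq_top_iff'.mpr (wedgeMap_mem (hmem j)))) ?_ ?_
    · have := LinearMap.finrank_range_le (wedgeMap (ω j))
      rw [Module.finrank_fin_fun] at this
      lia
    · rintro g hg - ⟨v, rfl⟩
      obtain ⟨t, ht⟩ := hG g hg
      exact ⟨_, (extSubst_wedgeMap (hinv g t ht j) v).symm⟩
    · intro hbot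
      have : NeZero d := ⟨by lia⟩
      refine hinj j (by lia) (Pi.single 0 1) (by simp) ?_
      exact LinearMap.congr_fun (LinearMap.range_eq_bot.mp hbot) _

end SymplecticNormal

/-- **Lemma (Guralnick–Tiep, Lemma `sp-wed`).**  Let `G ≤ GL(V)` have a normal subgroup
`N ≤ Sp(V)`.  Then (i) for every `1 ≤ k ≤ dim V − 1` the `N`-module `⋀^k(V)` contains a
submodule isomorphic to the trivial module `1_N` if `k` is even, and to `V|_N` if `k` is
odd; and (ii) if `N` is finite and `O^ℓ(N)` is not abelian (`ℓ = char F`), then `⋀^k(V)` is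
not irreducible over `G` for any `2 ≤ k ≤ dim V − 2`. -/
theorem normal_symplectic_subgroup (F : Type*) [Field F] [IsAlgClosed F] (d : ℕ)
    (J : Matrix (Fin d) (Fin d) F) (hJ : IsAltMat J)
    (G N : Subgroup (GL (Fin d) F)) (hNG : NormalIn N G) (hNSp : N ≤ SpGroup J) :
    (∀ k : ℕ, 1 ≤ k → k ≤ d - 1 →
      (Even k → ∃ x : ExteriorAlgebra F (Fin d → F), x ∈ ⋀[F]^k (Fin d → F) ∧ x ≠ 0 ∧
        ∀ n ∈ N, extSubst ((n : GL (Fin d) F) : Matrix (Fin d) (Fin d) F) x = x) ∧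
      (Odd k → ∃ φ : (Fin d → F) →ₗ[F] ExteriorAlgebra F (Fin d → F),
        Function.Injective φ ∧ (∀ v : Fin d → F, φ v ∈ ⋀[F]^k (Fin d → F)) ∧
        ∀ n ∈ N, ∀ v : Fin d → F,
          φ (((n : GL (Fin d) F) : Matrix (Fin d) (Fin d) F).mulVec v) =
            extSubst ((n : GL (Fin d) F) : Matrix (Fin d) (Fin d) F) (φ v))) ∧
    (Finite ↥N →
      (∃ a ∈ ellResidual (ringChar F) ↥N, ∃ b ∈ ellResidual (ringChar F) ↥N, a * b ≠ b * a) →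
      ∀ k : ℕ, 2 ≤ k → k ≤ d - 2 → ¬ ExtIrreducible G k) := by
  refine ⟨fun k hk hkd => ⟨?_, ?_⟩, ?_⟩
  · rintro ⟨j, rfl⟩
    obtain ⟨n, ω, hdn, hmem, hne, -, hinv⟩ := hJ.exists_dividedPower
    refine ⟨ω j, two_mul j ▸ hmem j, hne j (by lia), fun g hg => ?_⟩
    rw [hinv g 1 (by rw [transpose_mul_mul_eq_of_mem_SpGroup (hNSp hg), one_smul]), one_pow,
      one_smul]
  · rintro ⟨j, rfl⟩
    obtain ⟨n, ω, hdn, hmem, -, hinj, hinv⟩ := hJ.exists_dividedPower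
    refine ⟨wedgeMap (ω j), (injective_iff_map_eq_zero _).mpr fun v hv => ?_,
      wedgeMap_mem (hmem j), fun g hg v => ?_⟩
    · by_contra hv0
      exact hinj j (by lia) v hv0 hv
    · rw [extSubst_wedgeMap (hinv g 1
        (by rw [transpose_mul_mul_eq_of_mem_SpGroup (hNSp hg), one_smul]) j), one_pow, one_smul]
  · rintro - ⟨a, -, b, -, hab⟩ k hk hkd hirr
    have hkd' : k + 2 ≤ d := by lia
    exact not_extIrreducible_of_similitude hJ (fun g hg => exists_similitude hJ hNG hNSp
      (hirr.eq_smul_one_of_commute hNG hk hkd' a.2 b.2 fun h => hab (Subtype.ext h)) hg)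
      hk hkd' hirr

end GuralnickTiep
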